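/- arXiv:2106.09205 — 2 statements merged into one kernel-verified Lean document; each statement's English description precedes it below -/
import Mathlib

section
/- Let k ≥ 2 and let X_1,...,X_m ∈ ℂ^{d×d} be positive semidefinite Hermitian matrices of rank at most k with Σ_i X_i ⪯ I_d. Let ε := max_i tr(X_i). If ε ≤ (k−1)²/k, then the largest root of the mixed characteristic polynomial μ[X_1,...,X_m] is at most (√(1 − ε/(k−1)) + √ε)². -/
open Polynomial
open scoped ComplexOrder

/-- The mixed characteristic polynomial
`μ[X_1,…,X_m](x) = ∏_{i=1}^m (1 − ∂_{z_i}) det[x I_d + Σ_i z_i X_i] |_{z=0}`,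
computed in `(ℂ[x])[z_1,…,z_m]`. -/
noncomputable def mixedCharPoly {m d : ℕ}
    (X : Fin m → Matrix (Fin d) (Fin d) ℂ) : Polynomial ℂ :=
  MvPolynomial.eval (fun _ : Fin m => (0 : Polynomial ℂ)) <|
    (List.finRange m).foldr (fun i p => p - MvPolynomial.pderiv i p)
      (Matrix.det
        (Matrix.diagonal (fun _ : Fin d =>
            (MvPolynomial.C (Polynomial.X : Polynomial ℂ) :
              MvPolynomial (Fin m) (Polynomial ℂ)))
          + ∑ i : Fin m,
              (MvPolynomial.X i : MvPolynomial (Fin m) (Polynomial ℂ)) •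
                (X i).map (fun c => MvPolynomial.C (Polynomial.C c))))

/-- The largest (real) root of a real-rooted polynomial over `ℂ`. -/
noncomputable def maxRoot (p : Polynomial ℂ) : ℝ :=
  sSup {x : ℝ | p.eval (x : ℂ) = 0}

/-- The logarithmic derivative has negative imaginary part above all the roots. -/
theorem im_logDeriv_neg_of_roots_below (q : ℂ[X]) (x : ℂ) (hx : q.eval x ≠ 0)
    (hq : ∀ z ∈ q.roots, z.im < x.im) :
    q.derivative.eval x = 0 ∨ (q.derivative.eval x / q.eval x).im < 0 := by
  have hs : q.Splits := IsAlgClosed.splits q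
  rw [hs.eval_derivative_div_eval_of_ne_zero hx]
  by_cases h0 : q.roots = 0
  · left
    rw [hs.eval_derivative_eq_eval_mul_sum hx, h0]
    simp
  · right
    have key : ∀ s : Multiset ℂ, (∀ z ∈ s, z.im < x.im) →
        (s.map fun z => 1 / (x - z)).sum.im ≤ 0 ∧
          (s ≠ 0 → (s.map fun z => 1 / (x - z)).sum.im < 0) := by
      intro s
      induction s using Multiset.induction_on with
      | empty => simp
      | cons a s ih =>
        intro hz
        have h1 := (ih fun z h => hz z (Multiset.mem_cons_of_mem h)).1
        have h2 : (1 / (x - a)).im < 0 := by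
          have ha := hz a (Multiset.mem_cons_self a s)
          rw [one_div, Complex.inv_im]
          apply div_neg_of_neg_of_pos
          · simp; linarith
          · apply Complex.normSq_pos.mpr
            intro h
            rw [sub_eq_zero] at h
            rw [h] at ha
            exact lt_irrefl _ ha
        simp only [Multiset.map_cons, Multiset.sum_cons, Complex.add_im]
        exact ⟨by linarith, fun _ => by linarith⟩
    exact (key _ hq).2 h0

theorem splits_of_aeval_ne_zero (f : ℝ[X]) (hf : ∀ u : ℂ, 0 < u.im → aeval u f ≠ 0) :
    f.Splits := by
  refine Splits.of_splits_map (algebraMap ℝ ℂ) (IsAlgClosed.splits _) fun u hu => ?_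
  have hu0 : aeval u f = 0 := by
    have := (mem_roots'.mp hu).2
    rwa [IsRoot.def, eval_map_algebraMap] at this
  have him : u.im = 0 := by
    rcases lt_trichotomy u.im 0 with h | h | h
    · exfalso
      refine hf (starRingEnd ℂ u) (by simpa using h) ?_
      rw [aeval_conj, hu0, map_zero]
    · exact h
    · exact absurd hu0 (hf u h)
  exact ⟨u.re, by apply Complex.ext <;> simp [him]⟩

theorem norm_aeval_ge_of_roots_neg (f : ℝ[X]) (hs : f.Splits) (h0 : 0 < f.eval 0)
    (hneg : ∀ z ∈ f.roots, z < 0) (n : ℕ) (hn : f.natDegree ≤ n) (u : ℂ) (hu : 0 < u.im) :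
    f.eval 0 * (u.im / ‖u‖) ^ n ≤ ‖aeval u f‖ := by
  have hun : 0 < ‖u‖ := lt_of_lt_of_le hu ((le_abs_self _).trans (Complex.abs_im_le_norm u))
  have hr0 : 0 < u.im / ‖u‖ := div_pos hu hun
  have hr1 : u.im / ‖u‖ ≤ 1 := by
    rw [div_le_one hun]; exact (le_abs_self _).trans (Complex.abs_im_le_norm u)
  have hfac : ∀ z : ℝ, z < 0 → -z * (u.im / ‖u‖) ≤ ‖u - (z : ℂ)‖ := by
    intro z hz
    rw [← mul_div_assoc, div_le_iff₀ hun]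
    have h1 : ‖u - (z : ℂ)‖ * ‖u‖ = ‖(u - z) * starRingEnd ℂ u‖ := by simp
    rw [h1]
    refine le_trans (le_of_eq ?_) ((neg_le_abs _).trans (Complex.abs_im_le_norm _))
    simp; ring
  have e0 : f.eval 0 = |f.leadingCoeff| * (f.roots.map fun z => -z).prod := by
    have h := hs.eval_eq_prod_roots 0
    have hp : ∀ s : Multiset ℝ, (∀ z ∈ s, z < 0) → 0 ≤ (s.map fun z => -z).prod := by
      intro s hz
      apply Multiset.prod_nonneg
      intro a ha
      obtain ⟨z, hz', rfl⟩ := Multiset.mem_map.mp ha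
      linarith [hz z hz']
    simp only [zero_sub] at h
    rw [← abs_of_pos h0, h, abs_mul, abs_of_nonneg (hp _ hneg)]
  have e1 : ‖aeval u f‖ = |f.leadingCoeff| * (f.roots.map fun z : ℝ => ‖u - (z : ℂ)‖).prod := by
    conv_lhs => rw [hs.eq_prod_roots]
    rw [map_mul, aeval_C, norm_mul, map_multiset_prod, Multiset.map_map]
    congr 1
    · simp
    · generalize f.roots = s
      induction s using Multiset.induction_on with
      | empty => simp
      | cons a s ih =>
        rw [Multiset.map_cons, Multiset.prod_cons, norm_mul, ih, Multiset.map_cons,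
          Multiset.prod_cons]
        simp
  have key : ∀ s : Multiset ℝ, (∀ z ∈ s, z < 0) →
      (s.map fun z => -z).prod * (u.im / ‖u‖) ^ (s.card) ≤
        (s.map fun z : ℝ => ‖u - (z : ℂ)‖).prod ∧ 0 ≤ (s.map fun z => -z).prod := by
    intro s
    induction s using Multiset.induction_on with
    | empty => simp
    | cons a s ih =>
      intro hz
      obtain ⟨i1, i2⟩ := ih fun z h => hz z (Multiset.mem_cons_of_mem h)
      have ha := hz a (Multiset.mem_cons_self a s)
      simp only [Multiset.map_cons, Multiset.prod_cons, Multiset.card_cons]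
      refine ⟨?_, mul_nonneg (by linarith) i2⟩
      calc -a * (s.map fun z => -z).prod * (u.im / ‖u‖) ^ (s.card + 1)
          = (-a * (u.im / ‖u‖)) * ((s.map fun z => -z).prod * (u.im / ‖u‖) ^ s.card) := by ring
        _ ≤ _ := mul_le_mul (hfac a ha) i1 (mul_nonneg i2 (by positivity)) (norm_nonneg _)
  rw [e0, e1, mul_assoc]
  refine mul_le_mul_of_nonneg_left (le_trans ?_ (key _ hneg).1) (abs_nonneg _)
  refine mul_le_mul_of_nonneg_left ?_ (key _ hneg).2
  exact pow_le_pow_of_le_one hr0.le hr1 ((hs.natDegree_eq_card_roots ▸ hn))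

theorem wronskian_nonpos_of_im_nonpos (f g : ℝ[X])
    (h : ∀ u : ℂ, 0 < u.im → (aeval u g * starRingEnd ℂ (aeval u f)).im ≤ 0) (x : ℝ) :
    g.derivative.eval x * f.eval x - g.eval x * f.derivative.eval x ≤ 0 := by
  have hz : ∀ p : ℝ[X], HasDerivAt (fun y : ℝ => aeval ((x : ℂ) + y * Complex.I) p)
      (((p.derivative.eval x : ℝ) : ℂ) * Complex.I) 0 := by
    intro p
    have h1 : HasDerivAt (fun y : ℝ => (x : ℂ) + y * Complex.I) Complex.I 0 := by
      have := ((Complex.ofRealCLM.hasDerivAt (x := 0)).mul_const Complex.I).const_add (x : ℂ)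
      simpa using this
    have h2 := p.hasDerivAt_aeval ((x : ℂ) + (0 : ℝ) * Complex.I)
    have h3 := HasDerivAt.comp (0 : ℝ) h2 h1
    have e : aeval ((x : ℂ) + (0 : ℝ) * Complex.I) (derivative p)
        = (((derivative p).eval x : ℝ) : ℂ) := by
      simp only [Complex.ofReal_zero, zero_mul, add_zero]
      exact aeval_algebraMap_apply_eq_algebraMap_eval x _
    rw [e] at h3
    exact h3
  have hev : ∀ p : ℝ[X], aeval ((x : ℂ) + ((0 : ℝ) : ℂ) * Complex.I) p = ((p.eval x : ℝ) : ℂ) := by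
    intro p
    simp only [Complex.ofReal_zero, zero_mul, add_zero]
    exact aeval_algebraMap_apply_eq_algebraMap_eval x _
  have hd := (hz g).mul ((hz f).star)
  have hd2 : HasDerivAt (fun y : ℝ => (aeval ((x : ℂ) + y * Complex.I) g *
      starRingEnd ℂ (aeval ((x : ℂ) + y * Complex.I) f)).im)
      (g.derivative.eval x * f.eval x - g.eval x * f.derivative.eval x) 0 := by
    have := (Complex.imCLM.hasFDerivAt.comp_hasDerivAt (0 : ℝ) hd)
    rw [hev, hev] at this
    refine this.congr_deriv ?_
    simp
    ring
  have ht := hd2.tendsto_slope_zero_right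
  refine le_of_tendsto ht ?_
  filter_upwards [self_mem_nhdsWithin] with t (ht : 0 < t)
  have h0 : (aeval ((x : ℂ) + ((0 : ℝ) : ℂ) * Complex.I) g *
      starRingEnd ℂ (aeval ((x : ℂ) + ((0 : ℝ) : ℂ) * Complex.I) f)).im = 0 := by
    rw [hev, hev]; simp
  rw [h0, sub_zero, smul_eq_mul]
  apply mul_nonpos_of_nonneg_of_nonpos (by positivity)
  apply h
  simpa using ht

theorem eval_mul_eval_mul_im_pow_nonneg (h g : ℝ[X]) (a : ℝ) (r : ℕ)
    (him : ∀ u : ℂ, 0 < u.im →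
      (aeval u g * starRingEnd ℂ (aeval u ((X - C a) ^ r * h))).im ≤ 0)
    (w : ℂ) (hw : 0 < w.im) : 0 ≤ g.eval a * h.eval a * (w ^ r).im := by
  let F : ℝ → ℝ := fun t => (aeval ((a : ℂ) + t * w) g *
    starRingEnd ℂ (w ^ r * aeval ((a : ℂ) + t * w) h)).im
  have hc : Continuous F := by
    have h1 : ∀ p : ℝ[X], Continuous fun t : ℝ => aeval ((a : ℂ) + t * w) p := fun p =>
      p.continuous_aeval.comp (by fun_prop)
    exact Complex.continuous_im.comp ((h1 g).mul
      (Complex.continuous_conj.comp (continuous_const.mul (h1 h))))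
  have hF0 : F 0 = -(g.eval a * h.eval a * (w ^ r).im) := by
    have hev : ∀ p : ℝ[X], aeval ((a : ℂ) + ((0 : ℝ) : ℂ) * w) p = ((p.eval a : ℝ) : ℂ) := by
      intro p
      simp only [Complex.ofReal_zero, zero_mul, add_zero]
      exact aeval_algebraMap_apply_eq_algebraMap_eval a _
    simp only [F]
    rw [hev, hev, map_mul, Complex.conj_ofReal, mul_comm (starRingEnd ℂ (w ^ r)), ← mul_assoc,
      ← Complex.ofReal_mul, Complex.im_ofReal_mul, Complex.conj_im]
    ring
  have hneg : F 0 ≤ 0 := by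
    have ht : Filter.Tendsto F (nhdsWithin 0 (Set.Ioi 0)) (nhds (F 0)) :=
      (hc.tendsto 0).mono_left nhdsWithin_le_nhds
    refine le_of_tendsto ht ?_
    filter_upwards [self_mem_nhdsWithin] with t (ht : 0 < t)
    have h1 := him ((a : ℂ) + t * w) (by simpa using mul_pos ht hw)
    have h2 : (aeval ((a : ℂ) + t * w) g *
        starRingEnd ℂ (aeval ((a : ℂ) + t * w) ((X - C a) ^ r * h))) =
        ((t ^ r : ℝ) : ℂ) * (aeval ((a : ℂ) + t * w) g *
          starRingEnd ℂ (w ^ r * aeval ((a : ℂ) + t * w) h)) := by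
      simp only [map_mul, map_pow, map_sub, aeval_X, aeval_C, Complex.coe_algebraMap, map_add,
        Complex.conj_ofReal, Complex.ofReal_pow]
      ring
    rw [h2, Complex.im_ofReal_mul] at h1
    exact nonpos_of_mul_nonpos_right h1 (pow_pos ht r)
  linarith

/-- If `Im (g / f) ≤ 0` on the upper half-plane then `g` vanishes at the multiple real roots
of `f`. -/
theorem eval_eq_zero_of_two_le_rootMultiplicity (f g : ℝ[X]) (hf : f ≠ 0) (a : ℝ)
    (hr : 2 ≤ f.rootMultiplicity a)
    (him : ∀ u : ℂ, 0 < u.im → (aeval u g * starRingEnd ℂ (aeval u f)).im ≤ 0) :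
    g.eval a = 0 := by
  obtain ⟨h, hfh, hnd⟩ := f.exists_eq_pow_rootMultiplicity_mul_and_not_dvd hf a
  set r := f.rootMultiplicity a
  have hha : h.eval a ≠ 0 := fun h0 => hnd (dvd_iff_isRoot.mpr h0)
  rw [hfh] at him
  have key := eval_mul_eval_mul_im_pow_nonneg h g a r him
  have hr0 : (2 : ℝ) ≤ r := by exact_mod_cast hr
  have hexp : ∀ x : ℝ, 0 < x → x < r →
      0 < (Complex.exp (((Real.pi * (x / r) : ℝ) : ℂ) * Complex.I)).im := by
    intro x hx hxr
    rw [Complex.exp_ofReal_mul_I_im]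
    have : x / r < 1 := by rw [div_lt_one (by linarith)]; exact hxr
    apply Real.sin_pos_of_pos_of_lt_pi
    · have := Real.pi_pos; positivity
    · nlinarith [Real.pi_pos]
  have hpow : ∀ x : ℝ, (Complex.exp (((Real.pi * (x / r) : ℝ) : ℂ) * Complex.I) ^ r).im =
      Real.sin (Real.pi * x) := by
    intro x
    rw [← Complex.exp_nat_mul, ← Complex.exp_ofReal_mul_I_im]
    congr 2
    have : (r : ℂ) ≠ 0 := by
      have : (r : ℝ) ≠ 0 := by linarith
      exact_mod_cast this
    push_cast
    field_simp
  have k1 := key _ (hexp (1 / 2) (by norm_num) (by linarith))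
  have k2 := key _ (hexp (3 / 2) (by norm_num) (by linarith))
  rw [hpow] at k1 k2
  have s1 : Real.sin (Real.pi * (1 / 2)) = 1 := by
    rw [mul_one_div, Real.sin_pi_div_two]
  have s2 : Real.sin (Real.pi * (3 / 2)) = -1 := by
    rw [show Real.pi * (3 / 2) = Real.pi / 2 + Real.pi by ring, Real.sin_add_pi,
      Real.sin_pi_div_two]
  rw [s1] at k1
  rw [s2] at k2
  have : g.eval a * h.eval a = 0 := by linarith
  exact (mul_eq_zero.mp this).resolve_right hha

theorem exists_partialFraction_of_simple (f g : ℝ[X]) (hs : f.Splits) (hf : f ≠ 0)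
    (hdeg : g.natDegree ≤ f.natDegree) (hsimple : ∀ a, f.rootMultiplicity a ≤ 1)
    (him : ∀ u : ℂ, 0 < u.im → (aeval u g * starRingEnd ℂ (aeval u f)).im ≤ 0) :
    ∃ (c : ℝ) (S : Finset ℝ) (R : ℝ → ℝ), (∀ z ∈ S, f.IsRoot z ∧ 0 ≤ R z) ∧
      g = C c * f + ∑ z ∈ S, C (R z) * (f /ₘ (X - C z)) := by
  classical
  have hroot : ∀ z ∈ f.roots.toFinset, f.IsRoot z := fun z hz =>
    isRoot_of_mem_roots (Multiset.mem_toFinset.mp hz)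
  have hfac : ∀ z ∈ f.roots.toFinset, (X - C z) * (f /ₘ (X - C z)) = f := fun z hz =>
    mul_divByMonic_eq_iff_isRoot.mpr (hroot z hz)
  have hnz : ∀ z ∈ f.roots.toFinset, (f /ₘ (X - C z)).eval z ≠ 0 := by
    intro z hz h0
    have h1 : 1 < f.rootMultiplicity z := by
      rw [← Nat.succ_le_iff, le_rootMultiplicity_iff hf]
      obtain ⟨q, hq⟩ := dvd_iff_isRoot.mpr (show IsRoot (f /ₘ (X - C z)) z from h0)
      refine ⟨q, ?_⟩
      conv_lhs => rw [← hfac z hz, hq]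
      ring
    exact absurd h1 (not_lt.mpr (hsimple z))
  have hcard : f.roots.toFinset.card = f.natDegree := by
    rw [hs.natDegree_eq_card_roots, Multiset.toFinset_card_of_nodup]
    exact Multiset.nodup_iff_count_le_one.mpr fun a => by rw [count_roots]; exact hsimple a
  have hlt : ∀ z ∈ f.roots.toFinset, (f /ₘ (X - C z)).degree < f.natDegree := by
    intro z hz
    rw [← degree_eq_natDegree hf]
    exact degree_divByMonic_lt f (X - C z) hf (by simp)
  refine ⟨g.coeff f.natDegree / f.leadingCoeff, f.roots.toFinset,
    fun z => g.eval z / (f /ₘ (X - C z)).eval z, fun z hz => ⟨hroot z hz, ?_⟩, ?_⟩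
  · have := eval_mul_eval_mul_im_pow_nonneg (f /ₘ (X - C z)) g z 1
      (by rw [pow_one, hfac z hz]; exact him) Complex.I (by simp)
    simp only [pow_one, Complex.I_im, mul_one] at this
    beta_reduce
    rw [← mul_div_mul_right _ _ (hnz z hz)]
    exact div_nonneg this (mul_self_nonneg _)
  · rw [← sub_eq_iff_eq_add']
    refine eq_of_degrees_lt_of_eval_finset_eq f.roots.toFinset ?_ ?_ ?_
    · rw [hcard, degree_lt_iff_coeff_zero]
      intro m hm
      rcases hm.eq_or_lt with rfl | hm
      · rw [coeff_sub, coeff_C_mul, coeff_natDegree,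
          div_mul_cancel₀ _ (leadingCoeff_ne_zero.mpr hf), sub_self]
      · rw [coeff_sub, coeff_C_mul, coeff_eq_zero_of_natDegree_lt hm,
          coeff_eq_zero_of_natDegree_lt (hdeg.trans_lt hm)]
        simp
    · rw [hcard]
      refine (degree_sum_le _ _).trans_lt ?_
      rw [Finset.sup_lt_iff (WithBot.bot_lt_coe _)]
      intro z hz
      rw [← smul_eq_C_mul]
      exact (degree_smul_le _ _).trans_lt (hlt z hz)
    · intro z hz
      rw [eval_sub, eval_mul, (hroot z hz).eq_zero, mul_zero, sub_zero, eval_finsetSum,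
        Finset.sum_eq_single z]
      · rw [eval_mul, eval_C, div_mul_cancel₀ _ (hnz z hz)]
      · intro y hy hyz
        have := congrArg (eval z) (hfac y hy)
        rw [eval_mul, (hroot z hz).eq_zero] at this
        have h2 : (f /ₘ (X - C y)).eval z = 0 := by
          refine (mul_eq_zero.mp this).resolve_left ?_
          simpa [sub_eq_zero] using hyz.symm
        rw [eval_mul, h2, mul_zero]
      · intro h; exact absurd hz h

/-- If `f` splits over `ℝ` and `Im (g / f) ≤ 0` on the upper half-plane, then
`g / f = c + ∑ R z / (X - z)` with residues `R z ≥ 0`. -/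
theorem exists_partialFraction_of_im_nonpos (f g : ℝ[X]) (hs : f.Splits) (hf : f ≠ 0)
    (hdeg : g.natDegree ≤ f.natDegree)
    (him : ∀ u : ℂ, 0 < u.im → (aeval u g * starRingEnd ℂ (aeval u f)).im ≤ 0) :
    ∃ (c : ℝ) (S : Finset ℝ) (R : ℝ → ℝ), (∀ z ∈ S, f.IsRoot z ∧ 0 ≤ R z) ∧
      g = C c * f + ∑ z ∈ S, C (R z) * (f /ₘ (X - C z)) := by
  induction hn : f.natDegree using Nat.strong_induction_on generalizing f g with
  | _ n ih =>
  by_cases hsimple : ∀ a, f.rootMultiplicity a ≤ 1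
  · exact exists_partialFraction_of_simple f g hs hf hdeg hsimple him
  push Not at hsimple
  obtain ⟨a, ha⟩ := hsimple
  have hfa : f.IsRoot a := (rootMultiplicity_pos hf).mp (by omega)
  have hga : g.IsRoot a := eval_eq_zero_of_two_le_rootMultiplicity f g hf a ha him
  have hf1 := mul_divByMonic_eq_iff_isRoot.mpr hfa
  have hg1 := mul_divByMonic_eq_iff_isRoot.mpr hga
  have hfd := natDegree_divByMonic f (monic_X_sub_C a)
  have hgd := natDegree_divByMonic g (monic_X_sub_C a)
  rw [natDegree_X_sub_C] at hfd hgd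
  set f1 := f /ₘ (X - C a)
  set g1 := g /ₘ (X - C a)
  have hf10 : f1 ≠ 0 := by
    rintro h0
    rw [h0, mul_zero] at hf1
    exact hf hf1.symm
  have hpos : 0 < f.natDegree := by
    by_contra h0
    push Not at h0
    rw [eq_C_of_natDegree_le_zero h0] at hfa hf
    simp only [IsRoot.def, eval_C] at hfa
    rw [hfa, C_0] at hf
    exact hf rfl
  have him1 : ∀ u : ℂ, 0 < u.im → (aeval u g1 * starRingEnd ℂ (aeval u f1)).im ≤ 0 := by
    intro u hu
    have h := him u hu
    rw [← hf1, ← hg1] at h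
    have h2 : (aeval u ((X - C a) * g1) * starRingEnd ℂ (aeval u ((X - C a) * f1))) =
        ((Complex.normSq (u - a) : ℝ) : ℂ) * (aeval u g1 * starRingEnd ℂ (aeval u f1)) := by
      rw [Complex.normSq_eq_conj_mul_self]
      simp only [map_mul, map_sub, aeval_X, aeval_C, Complex.coe_algebraMap]
      ring
    rw [h2, Complex.im_ofReal_mul] at h
    refine nonpos_of_mul_nonpos_right h (Complex.normSq_pos.mpr ?_)
    intro h0
    have := congrArg Complex.im h0
    simp at this
    linarith
  obtain ⟨c, S, R, hR, he⟩ := ih f1.natDegree (by omega) f1 g1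
    (hs.of_dvd hf ⟨X - C a, by rw [mul_comm]; exact hf1.symm⟩) hf10 (by omega) him1 rfl
  refine ⟨c, S, R, fun z hz => ⟨?_, (hR z hz).2⟩, ?_⟩
  · rw [← hf1, IsRoot.def, eval_mul, (hR z hz).1.eq_zero, mul_zero]
  · have hdiv : ∀ z ∈ S, f /ₘ (X - C z) = (X - C a) * (f1 /ₘ (X - C z)) := by
      intro z hz
      have h1 := mul_divByMonic_eq_iff_isRoot.mpr (hR z hz).1
      have h2 : f = (X - C z) * ((X - C a) * (f1 /ₘ (X - C z))) := by
        rw [← hf1]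
        conv_lhs => rw [← h1]
        ring
      conv_lhs => rw [h2]
      exact mul_divByMonic_cancel_left _ (monic_X_sub_C z)
    rw [Finset.sum_congr rfl fun z hz => by rw [hdiv z hz], ← hg1, he, mul_add, Finset.mul_sum]
    congr 1
    · rw [← hf1]; ring
    · exact Finset.sum_congr rfl fun z _ => by ring

theorem natDegree_le_of_eval_le_const_mul (f g : ℝ[X]) (c : ℝ)
    (h0 : ∀ x, 0 ≤ x → 0 ≤ f.eval x ∧ 0 ≤ g.eval x)
    (h : ∀ x, 0 ≤ x → g.eval x ≤ c * f.eval x) : g.natDegree ≤ f.natDegree := by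
  by_contra hlt
  push Not at hlt
  have hg : g ≠ 0 := by
    rintro rfl
    simp at hlt
  have ho := isLittleO_atTop_of_degree_lt f g (degree_lt_degree hlt)
  have hb := ho.bound (show (0 : ℝ) < 1 / (2 * (|c| + 1)) by positivity)
  obtain ⟨x, hx, hxr, hx0⟩ := (hb.and ((eventually_atTop_not_isRoot g hg).and
    (Filter.eventually_ge_atTop (0 : ℝ)))).exists
  have hf := (h0 x hx0).1
  have hgx := lt_of_le_of_ne (h0 x hx0).2 (Ne.symm hxr)
  rw [Real.norm_of_nonneg hf, Real.norm_of_nonneg hgx.le, div_mul_eq_mul_div, one_mul,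
    le_div_iff₀ (by positivity)] at hx
  have h1 := h x hx0
  have h2 : c * f.eval x ≤ |c| * f.eval x := mul_le_mul_of_nonneg_right (le_abs_self c) hf
  nlinarith [abs_nonneg c]

theorem sum_inv_sub_shift_le (s : Multiset ℝ) (hneg : ∀ z ∈ s, z < 0) {δ φ K : ℝ} (hδ : 0 < δ)
    (hφ : 0 ≤ φ) (hK : 0 < K) (hcard : (s.card : ℝ) ≤ K)
    (hsum : (s.map fun z => 1 / (0 - z)).sum ≤ φ) :
    (s.map fun z => 1 / (δ - z)).sum ≤ φ / (1 + δ * φ / K) := by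
  set A : ℝ := 1 + δ * φ / K with hA
  have hA0 : 0 < A := by positivity
  have hterm : ∀ z : ℝ, z < 0 →
      1 / (δ - z) ≤ δ * (φ / K) ^ 2 / A ^ 2 + 1 / (0 - z) / A ^ 2 := by
    intro z hz
    have hA' : A = 1 + δ * (φ / K) := by rw [hA]; ring
    generalize φ / K = b at *
    have hz1 : 0 < δ - z := by linarith
    have hz2 : 0 < 0 - z := by linarith
    rw [← add_div, div_le_div_iff₀ hz1 (by positivity), hA']
    have e : (δ * b ^ 2 + 1 / (0 - z)) * (δ - z) - 1 * (1 + δ * b) ^ 2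
        = δ * (b * z + 1) ^ 2 / (0 - z) := by
      have : (0 - z) ≠ 0 := hz2.ne'
      have hz' : z ≠ 0 := hz.ne
      field_simp
      ring
    have : 0 ≤ δ * (b * z + 1) ^ 2 / (0 - z) := by positivity
    linarith
  have hall : (s.map fun z => 1 / (δ - z)).sum ≤
      s.card * (δ * (φ / K) ^ 2 / A ^ 2) + (s.map fun z => 1 / (0 - z)).sum / A ^ 2 := by
    clear hsum hcard
    induction s using Multiset.induction_on with
    | empty => simp
    | cons a s ih =>
      have h1 := ih fun z h => hneg z (Multiset.mem_cons_of_mem h)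
      have h2 := hterm a (hneg a (Multiset.mem_cons_self a s))
      simp only [Multiset.map_cons, Multiset.sum_cons, Multiset.card_cons, Nat.cast_add,
        Nat.cast_one, add_div, add_mul, one_mul]
      linarith
  calc _ ≤ _ := hall
    _ ≤ K * (δ * (φ / K) ^ 2 / A ^ 2) + φ / A ^ 2 := by gcongr
    _ = φ / A := by
      rw [hA]
      field_simp
      ring

theorem eval_shift_le_of_linear_factor (f : ℝ[X]) (hs : f.Splits) {δ z : ℝ} (hz : f.IsRoot z)
    (hz0 : z < 0) (hδ : 0 < δ) (h0 : 0 < f.eval 0) (h1 : 0 < f.eval δ)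
    (hsum : 1 / δ + ((f.roots.erase z).map fun w => 1 / (δ - w)).sum ≤ 1) :
    0 ≤ (f /ₘ (X - C z)).eval 0 * (f.eval δ - f.derivative.eval δ) -
      ((f /ₘ (X - C z)).eval δ - (f /ₘ (X - C z)).derivative.eval δ) * f.eval 0 := by
  have hfac := mul_divByMonic_eq_iff_isRoot.mpr hz
  have hf : f ≠ 0 := by rintro rfl; simp at h0
  set h := f /ₘ (X - C z)
  have hh : h ≠ 0 := by
    intro e
    rw [e, mul_zero] at hfac
    exact hf hfac.symm
  have hhs : h.Splits := hs.of_dvd hf ⟨X - C z, by rw [mul_comm]; exact hfac.symm⟩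
  have hroots : f.roots.erase z = h.roots := by
    rw [← hfac, roots_mul (hfac.symm ▸ hf), roots_X_sub_C, Multiset.singleton_add,
      Multiset.erase_cons_head]
  have e0 : f.eval 0 = -z * h.eval 0 := by
    conv_lhs => rw [← hfac]
    simp
  have e1 : f.eval δ = (δ - z) * h.eval δ := by
    conv_lhs => rw [← hfac]
    simp
  have e2 : f.derivative.eval δ = h.eval δ + (δ - z) * h.derivative.eval δ := by
    conv_lhs => rw [← hfac]
    simp
  have p0 : 0 < h.eval 0 := by
    rw [e0] at h0
    exact pos_of_mul_pos_right h0 (by linarith)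
  have p1 : 0 < h.eval δ := by
    rw [e1] at h1
    exact pos_of_mul_pos_right h1 (by linarith)
  rw [e0, e1, e2, hhs.eval_derivative_eq_eval_mul_sum p1.ne', ← hroots]
  set S := ((f.roots.erase z).map fun w => 1 / (δ - w)).sum
  have hS : 0 ≤ δ * (1 - S) - 1 := by
    have : δ * (1 / δ + S) ≤ δ * 1 := mul_le_mul_of_nonneg_left hsum hδ.le
    rw [mul_add, mul_one_div_cancel hδ.ne'] at this
    linarith
  have := mul_nonneg (mul_pos p0 p1).le hS
  nlinarith

/-- The univariate barrier argument: subtracting from `f` its derivative while shifting by `δ`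
does not increase any barrier `g / f` with `Im (g / f) ≤ 0` on the upper half-plane. -/
theorem univariate_barrier_shift (f : ℝ[X]) {δ φ K : ℝ} (hδ : 0 < δ) (hφ : 0 ≤ φ) (hK : 0 < K)
    (hcond : 1 / δ + φ / (1 + δ * φ / K) ≤ 1) (hs : f.Splits) (hneg : ∀ z ∈ f.roots, z < 0)
    (hdeg : (f.natDegree : ℝ) ≤ K + 1) (h0 : 0 < f.eval 0) (h1 : 0 < f.eval δ)
    (hbar : f.derivative.eval 0 ≤ φ * f.eval 0) :
    f.derivative.eval δ < f.eval δ ∧ ∀ g : ℝ[X], g.natDegree ≤ f.natDegree →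
      (∀ u : ℂ, 0 < u.im → (aeval u g * starRingEnd ℂ (aeval u f)).im ≤ 0) →
      (g.eval δ - g.derivative.eval δ) * f.eval 0 ≤
        g.eval 0 * (f.eval δ - f.derivative.eval δ) := by
  have hf : f ≠ 0 := by rintro rfl; simp at h0
  have hsum0 : (f.roots.map fun z => 1 / (0 - z)).sum ≤ φ := by
    rw [hs.eval_derivative_eq_eval_mul_sum h0.ne', mul_comm] at hbar
    exact le_of_mul_le_mul_right hbar h0
  have herase : ∀ z ∈ f.roots,
      1 / δ + ((f.roots.erase z).map fun w => 1 / (δ - w)).sum ≤ 1 := by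
    intro z hz
    refine le_trans (add_le_add_right ?_ _) hcond
    refine sum_inv_sub_shift_le _ (fun w hw => hneg w (Multiset.mem_of_mem_erase hw)) hδ hφ hK ?_ ?_
    · have hc : (f.roots.erase z).card + 1 = f.natDegree := by
        rw [Multiset.card_erase_add_one hz, hs.natDegree_eq_card_roots]
      have : ((f.roots.erase z).card : ℝ) + 1 = f.natDegree := by exact_mod_cast hc
      linarith
    · rw [← Multiset.cons_erase hz, Multiset.map_cons, Multiset.sum_cons] at hsum0
      have : 0 ≤ 1 / (0 - z) := one_div_nonneg.mpr (by linarith [hneg z hz])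
      linarith
  refine ⟨?_, fun g hg him => ?_⟩
  · rw [hs.eval_derivative_eq_eval_mul_sum h1.ne']
    refine mul_lt_of_lt_one_right h1 ?_
    by_cases hr : f.roots = 0
    · simp [hr]
    · obtain ⟨z, hz⟩ := Multiset.exists_mem_of_ne_zero hr
      have h := herase z hz
      rw [← Multiset.cons_erase hz, Multiset.map_cons, Multiset.sum_cons]
      have : 1 / (δ - z) < 1 / δ := one_div_lt_one_div_of_lt hδ (by linarith [hneg z hz])
      linarith
  · obtain ⟨c, S, R, hR, he⟩ := exists_partialFraction_of_im_nonpos f g hs hf hg him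
    have hnn : 0 ≤ ∑ z ∈ S, R z * ((f /ₘ (X - C z)).eval 0 * (f.eval δ - f.derivative.eval δ) -
        ((f /ₘ (X - C z)).eval δ - (f /ₘ (X - C z)).derivative.eval δ) * f.eval 0) := by
      refine Finset.sum_nonneg fun z hz => mul_nonneg (hR z hz).2 ?_
      have hzr : z ∈ f.roots := (mem_roots hf).mpr (hR z hz).1
      exact eval_shift_le_of_linear_factor f hs (hR z hz).1 (hneg z hzr) hδ h0 h1 (herase z hzr)
    simp only [mul_sub, sub_mul, Finset.sum_sub_distrib] at hnn
    rw [he]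
    simp only [eval_add, eval_mul, eval_C, eval_finsetSum, derivative_add, derivative_mul,
      derivative_C, derivative_sum, zero_mul, zero_add, add_mul, sub_mul, mul_sub, Finset.sum_mul]
    simp only [mul_assoc] at hnn ⊢
    linarith

theorem MvPolynomial.pderiv_comm {σ R : Type*} [CommRing R] (i j : σ) (p : MvPolynomial σ R) :
    pderiv i (pderiv j p) = pderiv j (pderiv i p) := by
  classical
  induction p using MvPolynomial.induction_on with
  | C a => simp
  | add p q hp hq => simp [hp, hq]
  | mul_X p n hp =>
    simp only [pderiv_mul, map_add, hp, pderiv_X, Pi.single_apply]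
    split_ifs <;> (simp; try ring)

theorem MvPolynomial.degreeOf_pderiv_le {σ R : Type*} [CommRing R] (i j : σ)
    (p : MvPolynomial σ R) : degreeOf j (pderiv i p) ≤ degreeOf j p := by
  rw [degreeOf_le_iff]
  intro m hm
  rw [mem_support_iff, coeff_pderiv] at hm
  have h := le_degreeOf_of_mem_support j (mem_support_iff.mpr (left_ne_zero_of_mul hm))
  exact le_trans (by simp) h

/-- The univariate polynomial `t ↦ p (b + t v)`. -/
noncomputable def lineRestrict {σ K : Type*} [CommRing K] [Algebra ℝ K]
    (p : MvPolynomial σ ℝ) (b v : σ → K) : K[X] :=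
  MvPolynomial.aeval (fun i => C (b i) + C (v i) * X) p

section LineRestrict

variable {σ K : Type*} [CommRing K] [Algebra ℝ K]

theorem eval_lineRestrict (p : MvPolynomial σ ℝ) (b v : σ → K) (u : K) :
    (lineRestrict p b v).eval u = MvPolynomial.aeval (fun i => b i + v i * u) p := by
  unfold lineRestrict
  induction p using MvPolynomial.induction_on with
  | C a => simp [Polynomial.algebraMap_apply]
  | add p q hp hq => simp [hp, hq]
  | mul_X p n hp => simp [hp]

theorem aeval_lineRestrict (p : MvPolynomial σ ℝ) (b v : σ → ℝ) (u : ℂ) :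
    aeval u (lineRestrict p b v) =
      MvPolynomial.aeval (fun i => (b i : ℂ) + (v i : ℂ) * u) p := by
  unfold lineRestrict
  rw [MvPolynomial.comp_aeval_apply]
  simp

theorem derivative_lineRestrict [DecidableEq σ] (p : MvPolynomial σ ℝ) (b : σ → K) (i : σ) :
    derivative (lineRestrict p b (Pi.single i 1)) =
      lineRestrict (MvPolynomial.pderiv i p) b (Pi.single i 1) := by
  unfold lineRestrict
  induction p using MvPolynomial.induction_on with
  | C a => simp [Polynomial.algebraMap_apply]
  | add p q hp hq => simp [hp, hq]
  | mul_X p n hp =>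
    simp only [map_mul, derivative_mul, hp, MvPolynomial.aeval_X, MvPolynomial.pderiv_mul, map_add,
      MvPolynomial.pderiv_X, derivative_C, derivative_X, mul_one, zero_mul, zero_add]
    congr 2
    by_cases h : n = i
    · subst h; simp
    · simp [Pi.single_apply, h]

theorem natDegree_lineRestrict_single_le [DecidableEq σ] (p : MvPolynomial σ ℝ) (b : σ → K)
    (i : σ) : (lineRestrict p b (Pi.single i 1)).natDegree ≤ p.degreeOf i := by
  unfold lineRestrict
  rw [MvPolynomial.aeval_def, MvPolynomial.eval₂_eq]
  refine natDegree_sum_le_of_forall_le _ _ fun d hd => ?_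
  refine natDegree_mul_le.trans ?_
  rw [Polynomial.algebraMap_apply, natDegree_C, zero_add]
  refine (natDegree_prod_le _ _).trans ?_
  have h1 : ∀ j ∈ d.support, natDegree ((C (b j) +
      C ((Pi.single i 1 : σ → K) j) * X) ^ d j) ≤ if i = j then d i else 0 := by
    intro j _
    refine natDegree_pow_le.trans ?_
    split_ifs with h
    · subst h
      have : natDegree (C (b i) + C ((Pi.single i 1 : σ → K) i) * X) ≤ 1 := by
        compute_degree
      nlinarith
    · simp [Ne.symm h]
  refine (Finset.sum_le_sum h1).trans ?_
  rw [Finset.sum_ite_eq]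
  split_ifs
  · exact MvPolynomial.le_degreeOf_of_mem_support i hd
  · exact Nat.zero_le _

theorem natDegree_lineRestrict_le (p : MvPolynomial σ ℝ) (b v : σ → K) :
    (lineRestrict p b v).natDegree ≤ p.totalDegree := by
  have h1 : ∀ i, (C (b i) + C (v i) * X : K[X]).natDegree ≤ 1 := fun i => by compute_degree
  unfold lineRestrict
  rw [MvPolynomial.aeval_def, MvPolynomial.eval₂_eq]
  refine natDegree_sum_le_of_forall_le _ _ fun d hd => ?_
  refine natDegree_mul_le.trans ?_
  rw [Polynomial.algebraMap_apply, natDegree_C, zero_add]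
  refine (natDegree_prod_le _ _).trans (le_trans ?_ (MvPolynomial.le_totalDegree hd))
  exact Finset.sum_le_sum fun j _ =>
    natDegree_pow_le.trans ((Nat.mul_le_mul_left _ (h1 j)).trans_eq (mul_one _))

end LineRestrict

/-- A real polynomial with no zeros in the product of open upper half-planes. -/
def IsRealStable {σ : Type*} (p : MvPolynomial σ ℝ) : Prop :=
  ∀ z : σ → ℂ, (∀ i, 0 < (z i).im) → MvPolynomial.aeval z p ≠ 0

/-- `p` is positive on the orthant with vertex `a`. -/
def IsAboveRoots {σ : Type*} (p : MvPolynomial σ ℝ) (a : σ → ℝ) : Prop :=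
  ∀ b, a ≤ b → 0 < MvPolynomial.eval b p

section Stable

variable {σ : Type*} {p : MvPolynomial σ ℝ}

theorem IsRealStable.pderiv_im_neg (hp : IsRealStable p) (j : σ) (z : σ → ℂ)
    (hz : ∀ i, 0 < (z i).im) :
    MvPolynomial.aeval z (MvPolynomial.pderiv j p) = 0 ∨
      (MvPolynomial.aeval z (MvPolynomial.pderiv j p) / MvPolynomial.aeval z p).im < 0 := by
  classical
  have hq0 : ∀ q : MvPolynomial σ ℝ, (lineRestrict q z (Pi.single j 1)).eval 0 =
      MvPolynomial.aeval z q := fun q => by simp [eval_lineRestrict]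
  have h := im_logDeriv_neg_of_roots_below (lineRestrict p z (Pi.single j 1)) 0
    (by rw [hq0]; exact hp z hz) ?_
  · rwa [derivative_lineRestrict, hq0, hq0] at h
  · intro τ hτ
    by_contra hlt
    push Not at hlt
    have h0 : (lineRestrict p z (Pi.single j 1)).eval τ = 0 := isRoot_of_mem_roots hτ
    rw [eval_lineRestrict] at h0
    refine hp _ (fun i => ?_) h0
    by_cases h : i = j
    · subst h
      simp only [Pi.single_eq_same, one_mul, Complex.add_im]
      simp only [Complex.zero_im] at hlt
      linarith [hz i]
    · simpa [Pi.single_apply, h] using hz i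

theorem IsRealStable.sub_pderiv (hp : IsRealStable p) (j : σ) :
    IsRealStable (p - MvPolynomial.pderiv j p) := by
  intro z hz h
  rw [map_sub, sub_eq_zero] at h
  have hpz := hp z hz
  rcases hp.pderiv_im_neg j z hz with h1 | h1
  · exact hpz (h.trans h1)
  · rw [← h, div_self hpz] at h1
    simp at h1

theorem IsRealStable.im_lineRestrict_nonpos (hp : IsRealStable p) (j : σ) (b v : σ → ℝ)
    (hv : 0 ≤ v) (u : ℂ) (hu : 0 < u.im) :
    (aeval u (lineRestrict (MvPolynomial.pderiv j p) b v) *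
      starRingEnd ℂ (aeval u (lineRestrict p b v))).im ≤ 0 := by
  let ℓ : MvPolynomial σ ℝ → ℂ[X] := fun q =>
    lineRestrict q (fun i => (b i : ℂ) + v i * u) fun _ => u
  have hℓ : ∀ q (t : ℝ), (ℓ q).eval (t : ℂ) =
      MvPolynomial.aeval (fun i => (b i : ℂ) + v i * u + u * t) q := fun q t => by
    simp [ℓ, eval_lineRestrict]
  let F : ℝ → ℝ := fun t => ((ℓ (MvPolynomial.pderiv j p)).eval (t : ℂ) *
    starRingEnd ℂ ((ℓ p).eval (t : ℂ))).im
  have hc : Continuous F := by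
    have h1 : ∀ q, Continuous fun t : ℝ => (ℓ q).eval (t : ℂ) := fun q =>
      (ℓ q).continuous.comp Complex.continuous_ofReal
    exact Complex.continuous_im.comp ((h1 _).mul (Complex.continuous_conj.comp (h1 _)))
  have hF0 : F 0 = (aeval u (lineRestrict (MvPolynomial.pderiv j p) b v) *
      starRingEnd ℂ (aeval u (lineRestrict p b v))).im := by
    simp only [F, hℓ, aeval_lineRestrict, Complex.ofReal_zero, mul_zero, add_zero]
  rw [← hF0]
  have ht : Filter.Tendsto F (nhdsWithin 0 (Set.Ioi 0)) (nhds (F 0)) :=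
    (hc.tendsto 0).mono_left nhdsWithin_le_nhds
  refine le_of_tendsto ht ?_
  filter_upwards [self_mem_nhdsWithin] with t (ht : 0 < t)
  have hz : ∀ i, 0 < ((b i : ℂ) + v i * u + u * t).im := by
    intro i
    have := mul_nonneg (hv i) hu.le
    have := mul_pos hu ht
    simp
    linarith
  simp only [F, hℓ]
  have hpz := hp _ hz
  have key : ∀ c e : ℂ, e ≠ 0 → (c / e).im < 0 → (c * starRingEnd ℂ e).im ≤ 0 := by
    intro c e he0 h
    have he : c * starRingEnd ℂ e = ((Complex.normSq e : ℝ) : ℂ) * (c / e) := by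
      rw [Complex.normSq_eq_conj_mul_self]
      field_simp
    rw [he, Complex.im_ofReal_mul]
    exact mul_nonpos_of_nonneg_of_nonpos (Complex.normSq_nonneg e) h.le
  rcases hp.pderiv_im_neg j _ hz with h | h
  · rw [h]; simp
  · exact key _ _ hpz h

theorem IsAboveRoots.mono {a b : σ → ℝ} (h : IsAboveRoots p a) (hab : a ≤ b) :
    IsAboveRoots p b := fun c hc => h c (hab.trans hc)

theorem eval_lineRestrict_real (q : MvPolynomial σ ℝ) (b v : σ → ℝ) (u : ℝ) :
    (lineRestrict q b v).eval u = MvPolynomial.eval (fun i => b i + v i * u) q := by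
  rw [eval_lineRestrict, MvPolynomial.aeval_eq_eval]

theorem IsAboveRoots.lineRestrict_eval_pos {b v : σ → ℝ} (h : IsAboveRoots p b) (hv : 0 ≤ v)
    {x : ℝ} (hx : 0 ≤ x) : 0 < (lineRestrict p b v).eval x := by
  rw [eval_lineRestrict_real]
  refine h _ fun i => ?_
  have := mul_nonneg (hv i) hx
  simp only
  linarith

theorem IsAboveRoots.roots_lineRestrict_neg {b v : σ → ℝ} (h : IsAboveRoots p b) (hv : 0 ≤ v) :
    ∀ z ∈ (lineRestrict p b v).roots, z < 0 := by
  intro z hz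
  by_contra h0
  push Not at h0
  exact (h.lineRestrict_eval_pos hv h0).ne' (isRoot_of_mem_roots hz)

theorem IsRealStable.splits_lineRestrict (hp : IsRealStable p) {b v : σ → ℝ}
    (h : IsAboveRoots p b) (hv : 0 ≤ v) : (lineRestrict p b v).Splits := by
  refine splits_of_aeval_ne_zero _ fun u hu => ?_
  let ℓ : ℂ[X] := lineRestrict p (fun i => (b i : ℂ) + v i * u) fun _ => u
  have hℓ : ∀ t : ℝ, ℓ.eval (t : ℂ) = aeval u (lineRestrict p b fun i => v i + t) := fun t => by
    rw [aeval_lineRestrict, eval_lineRestrict]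
    congr 2
    ext i
    push_cast
    ring
  have hc : Continuous fun t : ℝ => ‖ℓ.eval (t : ℂ)‖ :=
    (ℓ.continuous.comp Complex.continuous_ofReal).norm
  have ht := (hc.tendsto 0).mono_left (nhdsWithin_le_nhds (s := Set.Ioi 0))
  have hlow : MvPolynomial.eval b p * (u.im / ‖u‖) ^ p.totalDegree ≤
      ‖ℓ.eval ((0 : ℝ) : ℂ)‖ := by
    refine ge_of_tendsto ht ?_
    filter_upwards [self_mem_nhdsWithin] with t (ht : 0 < t)
    have hvt : (0 : σ → ℝ) ≤ fun i => v i + t := fun i => add_nonneg (hv i) ht.le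
    have hs : (lineRestrict p b fun i => v i + t).Splits := by
      refine splits_of_aeval_ne_zero _ fun w hw => ?_
      rw [aeval_lineRestrict]
      refine hp _ fun i => ?_
      have : 0 < v i + t := add_pos_of_nonneg_of_pos (hv i) ht
      rw [Complex.add_im, Complex.ofReal_im, zero_add, Complex.im_ofReal_mul]
      exact mul_pos this hw
    have := norm_aeval_ge_of_roots_neg _ hs (h.lineRestrict_eval_pos hvt le_rfl)
      (h.roots_lineRestrict_neg hvt) p.totalDegree (natDegree_lineRestrict_le _ _ _) u hu
    rw [hℓ]
    simpa [eval_lineRestrict_real] using this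
  intro h0
  have hun : 0 < ‖u‖ := lt_of_lt_of_le hu ((le_abs_self _).trans (Complex.abs_im_le_norm u))
  have h1 : 0 < MvPolynomial.eval b p * (u.im / ‖u‖) ^ p.totalDegree :=
    mul_pos (h b le_rfl) (pow_pos (div_pos hu hun) _)
  rw [hℓ] at hlow
  simp only [add_zero] at hlow
  rw [h0, norm_zero] at hlow
  linarith

theorem IsRealStable.eval_pderiv_nonneg (hp : IsRealStable p) (j : σ) {b : σ → ℝ}
    (h : IsAboveRoots p b) : 0 ≤ MvPolynomial.eval b (MvPolynomial.pderiv j p) := by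
  classical
  have hv : (0 : σ → ℝ) ≤ Pi.single j 1 := Pi.single_nonneg.mpr zero_le_one
  have h0 := h.lineRestrict_eval_pos hv (le_refl 0)
  have hd := (hp.splits_lineRestrict h hv).eval_derivative_eq_eval_mul_sum h0.ne'
  rw [derivative_lineRestrict, eval_lineRestrict_real] at hd
  simp only [mul_zero, add_zero] at hd
  rw [hd]
  refine mul_nonneg h0.le (Multiset.sum_nonneg fun x hx => ?_)
  obtain ⟨z, hz, rfl⟩ := Multiset.mem_map.mp hx
  have := h.roots_lineRestrict_neg hv z hz
  exact one_div_nonneg.mpr (by linarith)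

theorem IsRealStable.eval_pderiv_lineRestrict_le (hp : IsRealStable p) (j : σ) {b v : σ → ℝ}
    (h : IsAboveRoots p b) (hv : 0 ≤ v) {x : ℝ} (hx : 0 ≤ x) :
    (lineRestrict (MvPolynomial.pderiv j p) b v).eval x * MvPolynomial.eval b p ≤
      MvPolynomial.eval b (MvPolynomial.pderiv j p) * (lineRestrict p b v).eval x := by
  set f := lineRestrict p b v
  set g := lineRestrict (MvPolynomial.pderiv j p) b v
  have hpos : ∀ y, 0 ≤ y → 0 < f.eval y := fun y hy => h.lineRestrict_eval_pos hv hy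
  have hanti : AntitoneOn (fun y => g.eval y / f.eval y) (Set.Ici 0) := by
    refine antitoneOn_of_deriv_nonpos (convex_Ici 0) ?_ ?_ ?_
    · exact g.continuous.continuousOn.div f.continuous.continuousOn fun y hy => (hpos y hy).ne'
    · intro y hy
      rw [interior_Ici] at hy
      exact (g.differentiable.differentiableAt.div f.differentiable.differentiableAt
        (hpos y (le_of_lt hy)).ne').differentiableWithinAt
    · intro y hy
      rw [interior_Ici] at hy
      have hd := ((g.hasDerivAt y).div (f.hasDerivAt y) (hpos y (le_of_lt hy)).ne').deriv
      rw [show (fun y => g.eval y / f.eval y) = (fun y => g.eval y) / fun y => f.eval y from rfl,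
        hd]
      exact div_nonpos_of_nonpos_of_nonneg
        (wronskian_nonpos_of_im_nonpos f g (hp.im_lineRestrict_nonpos j b v hv) y) (sq_nonneg _)
  have := hanti (Set.mem_Ici.mpr le_rfl) (Set.mem_Ici.mpr hx) hx
  have e : ∀ q : MvPolynomial σ ℝ, (lineRestrict q b v).eval 0 = MvPolynomial.eval b q :=
    fun q => by simp [eval_lineRestrict_real]
  rw [div_le_div_iff₀ (hpos x hx) (hpos 0 le_rfl)] at this
  rwa [e, e] at this

theorem IsRealStable.eval_pderiv_mul_le (hp : IsRealStable p) (j : σ) {a b : σ → ℝ}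
    (h : IsAboveRoots p a) (hab : a ≤ b) :
    MvPolynomial.eval b (MvPolynomial.pderiv j p) * MvPolynomial.eval a p ≤
      MvPolynomial.eval a (MvPolynomial.pderiv j p) * MvPolynomial.eval b p := by
  have := hp.eval_pderiv_lineRestrict_le j h (v := b - a) (sub_nonneg.mpr hab) zero_le_one
  simpa [eval_lineRestrict_real] using this

theorem IsRealStable.natDegree_lineRestrict_pderiv_le (hp : IsRealStable p) (j : σ)
    {b v : σ → ℝ} (h : IsAboveRoots p b) (hv : 0 ≤ v) :
    (lineRestrict (MvPolynomial.pderiv j p) b v).natDegree ≤ (lineRestrict p b v).natDegree := by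
  have hpb := h b le_rfl
  refine natDegree_le_of_eval_le_const_mul _ _
    (MvPolynomial.eval b (MvPolynomial.pderiv j p) / MvPolynomial.eval b p) (fun x hx => ?_)
    fun x hx => ?_
  · refine ⟨(h.lineRestrict_eval_pos hv hx).le, ?_⟩
    rw [eval_lineRestrict_real]
    refine hp.eval_pderiv_nonneg j (h.mono fun i => ?_)
    have := mul_nonneg (hv i) hx
    simp only
    linarith
  · rw [div_mul_eq_mul_div, le_div_iff₀ hpb]
    exact hp.eval_pderiv_lineRestrict_le j h hv hx

/-- Applying `1 - ∂ᵢ` and moving the base point by `δ` in direction `i` does not increase the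
barrier functions `∂ⱼ p / p` below the bound `φ`. -/
theorem IsRealStable.barrier_shift [DecidableEq σ] (hp : IsRealStable p) {a : σ → ℝ}
    (h : IsAboveRoots p a) (i : σ) {δ φ K : ℝ} (hδ : 0 < δ) (hφ : 0 ≤ φ) (hK : 0 < K)
    (hcond : 1 / δ + φ / (1 + δ * φ / K) ≤ 1) (hdeg : (p.degreeOf i : ℝ) ≤ K + 1)
    (hbar : MvPolynomial.eval a (MvPolynomial.pderiv i p) ≤ φ * MvPolynomial.eval a p) :
    IsAboveRoots (p - MvPolynomial.pderiv i p) (a + Pi.single i δ) ∧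
      ∀ j, MvPolynomial.eval a (MvPolynomial.pderiv j p) ≤ φ * MvPolynomial.eval a p →
        MvPolynomial.eval (a + Pi.single i δ)
            (MvPolynomial.pderiv j (p - MvPolynomial.pderiv i p)) ≤
          φ * MvPolynomial.eval (a + Pi.single i δ) (p - MvPolynomial.pderiv i p) := by
  have hv : (0 : σ → ℝ) ≤ Pi.single i 1 := Pi.single_nonneg.mpr zero_le_one
  have e0 : ∀ q : MvPolynomial σ ℝ, (lineRestrict q a (Pi.single i 1)).eval 0 =
      MvPolynomial.eval a q := fun q => by simp [eval_lineRestrict_real]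
  have e1 : ∀ q : MvPolynomial σ ℝ, (lineRestrict q a (Pi.single i 1)).eval δ =
      MvPolynomial.eval (a + Pi.single i δ) q := fun q => by
    rw [eval_lineRestrict_real]
    congr 2
    ext k
    by_cases hk : k = i
    · subst hk; simp
    · simp [hk]
  have hpa := h a le_rfl
  have haa : a ≤ a + Pi.single i δ := le_add_of_nonneg_right (Pi.single_nonneg.mpr hδ.le)
  have hpa' := h _ haa
  obtain ⟨h1, h2⟩ := univariate_barrier_shift (lineRestrict p a (Pi.single i 1)) hδ hφ hK hcond
    (hp.splits_lineRestrict h hv) (h.roots_lineRestrict_neg hv)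
    (le_trans (by exact_mod_cast natDegree_lineRestrict_single_le p a i) hdeg)
    (by rwa [e0]) (by rwa [e1]) (by rwa [derivative_lineRestrict, e0, e0])
  rw [derivative_lineRestrict, e1, e1] at h1
  refine ⟨fun b hb => ?_, fun j hj => ?_⟩
  · have h3 := hp.eval_pderiv_mul_le i (h.mono haa) hb
    have h4 := mul_lt_mul_of_pos_right h1 (h b (haa.trans hb))
    rw [map_sub, sub_pos]
    exact lt_of_mul_lt_mul_right (h3.trans_lt (h4.trans_eq (mul_comm _ _))) hpa'.le
  · have h3 := h2 (lineRestrict (MvPolynomial.pderiv j p) a (Pi.single i 1))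
      (hp.natDegree_lineRestrict_pderiv_le j h hv) (hp.im_lineRestrict_nonpos j a _ hv)
    simp only [derivative_lineRestrict, e0, e1] at h3
    rw [map_sub, MvPolynomial.pderiv_comm, map_sub, map_sub]
    refine le_of_mul_le_mul_right (h3.trans ?_) hpa
    calc _ ≤ (φ * MvPolynomial.eval a p) * _ := mul_le_mul_of_nonneg_right hj (sub_pos.mpr h1).le
      _ = _ := by ring

theorem IsRealStable.foldr_sub_pderiv [DecidableEq σ] (hp : IsRealStable p) {a : σ → ℝ}
    (h : IsAboveRoots p a) {δ φ K : ℝ} (hδ : 0 < δ) (hφ : 0 ≤ φ) (hK : 0 < K)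
    (hcond : 1 / δ + φ / (1 + δ * φ / K) ≤ 1) (hdeg : ∀ i, (p.degreeOf i : ℝ) ≤ K + 1)
    (hbar : ∀ i, MvPolynomial.eval a (MvPolynomial.pderiv i p) ≤ φ * MvPolynomial.eval a p)
    (l : List σ) (hl : l.Nodup) :
    IsAboveRoots (l.foldr (fun i q => q - MvPolynomial.pderiv i q) p)
      (fun i => a i + if i ∈ l then δ else 0) := by
  suffices H : IsRealStable (l.foldr (fun i q => q - MvPolynomial.pderiv i q) p) ∧
      IsAboveRoots (l.foldr (fun i q => q - MvPolynomial.pderiv i q) p)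
        (fun i => a i + if i ∈ l then δ else 0) ∧
      (∀ i, ((l.foldr (fun i q => q - MvPolynomial.pderiv i q) p).degreeOf i : ℝ) ≤ K + 1) ∧
      ∀ j, j ∉ l → MvPolynomial.eval (fun i => a i + if i ∈ l then δ else 0)
          (MvPolynomial.pderiv j (l.foldr (fun i q => q - MvPolynomial.pderiv i q) p)) ≤
        φ * MvPolynomial.eval (fun i => a i + if i ∈ l then δ else 0)
          (l.foldr (fun i q => q - MvPolynomial.pderiv i q) p) from H.2.1
  induction l with
  | nil => simpa using ⟨hp, h, hdeg, hbar⟩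
  | cons i l ih =>
    obtain ⟨hil, hl'⟩ := List.nodup_cons.mp hl
    obtain ⟨s1, s2, s3, s4⟩ := ih hl'
    rw [List.foldr_cons]
    set q := l.foldr (fun i q => q - MvPolynomial.pderiv i q) p
    have he : (fun k => a k + if k ∈ i :: l then δ else 0) =
        (fun k => a k + if k ∈ l then δ else 0) + Pi.single i δ := by
      ext k
      by_cases hk : k = i
      · subst hk; simp [hil]
      · simp [hk]
    rw [he]
    obtain ⟨t1, t2⟩ := s1.barrier_shift s2 i hδ hφ hK hcond (s3 i) (s4 i hil)
    refine ⟨s1.sub_pderiv i, t1, fun j => ?_, fun j hj => t2 j (s4 j fun hjl => ?_)⟩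
    · refine le_trans ?_ (s3 j)
      exact_mod_cast (MvPolynomial.degreeOf_sub_le j q _).trans
        (max_le le_rfl (MvPolynomial.degreeOf_pderiv_le i j q))
    · exact hj (List.mem_cons_of_mem i hjl)

end Stable

section DetPencil

variable {m d : ℕ}

/-- The polynomial `det (x + ∑ i, z i • X i)` in the variables `z i`. -/
noncomputable def detPencil (x : ℂ) (X : Fin m → Matrix (Fin d) (Fin d) ℂ) :
    MvPolynomial (Fin m) ℂ :=
  Matrix.det (Matrix.diagonal (fun _ => MvPolynomial.C x) +
    ∑ i, (MvPolynomial.X i : MvPolynomial (Fin m) ℂ) • (X i).map MvPolynomial.C)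

theorem eval_detPencil (x : ℂ) (X : Fin m → Matrix (Fin d) (Fin d) ℂ) (z : Fin m → ℂ) :
    MvPolynomial.eval z (detPencil x X) = Matrix.det (x • 1 + ∑ i, z i • X i) := by
  rw [detPencil, RingHom.map_det]
  congr 1
  ext r c
  by_cases h : r = c <;> simp [Matrix.sum_apply, h]

theorem map_foldr_sub_pderiv {σ R S : Type*} [CommRing R] [CommRing S] (f : R →+* S)
    (l : List σ) (p : MvPolynomial σ R) :
    MvPolynomial.map f (l.foldr (fun i q => q - MvPolynomial.pderiv i q) p) =
      l.foldr (fun i q => q - MvPolynomial.pderiv i q) (MvPolynomial.map f p) := by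
  induction l with
  | nil => rfl
  | cons i l ih => simp only [List.foldr_cons, map_sub, ← ih, MvPolynomial.pderiv_map]

theorem eval_mixedCharPoly (X : Fin m → Matrix (Fin d) (Fin d) ℂ) (x : ℂ) :
    (mixedCharPoly X).eval x = MvPolynomial.eval 0
      ((List.finRange m).foldr (fun i q => q - MvPolynomial.pderiv i q) (detPencil x X)) := by
  rw [mixedCharPoly, ← coe_evalRingHom, MvPolynomial.map_eval, map_foldr_sub_pderiv]
  have h0 : (evalRingHom x : ℂ[X] → ℂ) ∘ (fun _ : Fin m => (0 : ℂ[X])) = 0 := by ext; simp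
  rw [h0]
  congr 2
  · rw [detPencil, RingHom.map_det]
    congr 1
    ext r c
    by_cases h : r = c <;> simp [Matrix.sum_apply, h]

theorem map_conj_detPencil (x : ℝ) {X : Fin m → Matrix (Fin d) (Fin d) ℂ}
    (hX : ∀ i, (X i).IsHermitian) :
    MvPolynomial.map (starRingEnd ℂ) (detPencil x X) = detPencil x X := by
  rw [detPencil, RingHom.map_det, ← Matrix.det_transpose]
  congr 1
  ext1 r c
  have h : ∀ i, starRingEnd ℂ (X i c r) = X i r c := fun i => (hX i).apply r c
  by_cases hrc : c = r
  · subst hrc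
    simp [Matrix.sum_apply, h]
  · simp [Matrix.sum_apply, h, hrc, Ne.symm hrc]

theorem exists_map_eq_detPencil (x : ℝ) {X : Fin m → Matrix (Fin d) (Fin d) ℂ}
    (hX : ∀ i, (X i).IsHermitian) :
    ∃ p : MvPolynomial (Fin m) ℝ, MvPolynomial.map (algebraMap ℝ ℂ) p = detPencil x X := by
  rw [← Set.mem_range, MvPolynomial.mem_range_map_iff_coeffs_subset]
  intro c hc
  obtain ⟨n, _, rfl⟩ := MvPolynomial.mem_coeffs_iff.mp hc
  have h := congrArg (MvPolynomial.coeff n) (map_conj_detPencil x hX)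
  rw [MvPolynomial.coeff_map] at h
  obtain ⟨r, hr⟩ := Complex.conj_eq_iff_real.mp h
  exact ⟨r, hr.symm⟩

theorem aeval_eq_det {p : MvPolynomial (Fin m) ℝ} {x : ℂ}
    {X : Fin m → Matrix (Fin d) (Fin d) ℂ}
    (hp : MvPolynomial.map (algebraMap ℝ ℂ) p = detPencil x X) (z : Fin m → ℂ) :
    MvPolynomial.aeval z p = Matrix.det (x • 1 + ∑ i, z i • X i) := by
  rw [← eval_detPencil, ← hp, MvPolynomial.eval_map, MvPolynomial.aeval_def]

theorem ofReal_eval_eq_det {p : MvPolynomial (Fin m) ℝ} {x : ℂ}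
    {X : Fin m → Matrix (Fin d) (Fin d) ℂ}
    (hp : MvPolynomial.map (algebraMap ℝ ℂ) p = detPencil x X) (b : Fin m → ℝ) :
    (MvPolynomial.eval b p : ℂ) = Matrix.det (x • 1 + ∑ i, (b i : ℂ) • X i) := by
  rw [← aeval_eq_det hp, ← MvPolynomial.aeval_eq_eval]
  exact (MvPolynomial.aeval_algebraMap_apply ℂ b p).symm

theorem isRealStable_of_map_eq_detPencil {p : MvPolynomial (Fin m) ℝ} {x : ℝ} (hx : 0 < x)
    {X : Fin m → Matrix (Fin d) (Fin d) ℂ} (hX : ∀ i, (X i).PosSemidef)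
    (hp : MvPolynomial.map (algebraMap ℝ ℂ) p = detPencil x X) : IsRealStable p := by
  intro z hz h0
  rw [aeval_eq_det hp] at h0
  obtain ⟨v, hv, hMv⟩ := Matrix.exists_mulVec_eq_zero_iff.mpr h0
  have hq := fun i => Complex.nonneg_iff.mp ((hX i).dotProduct_mulVec_nonneg v)
  set q : Fin m → ℂ := fun i => star v ⬝ᵥ (X i).mulVec v
  have h1 : (x : ℂ) * (star v ⬝ᵥ v) + ∑ i, z i * q i = 0 := by
    have := congrArg (star v ⬝ᵥ ·) hMv
    simpa [Matrix.add_mulVec, Matrix.sum_mulVec, Matrix.smul_mulVec, dotProduct_add,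
      dotProduct_sum, dotProduct_smul] using this
  have hvv : 0 < star v ⬝ᵥ v := Matrix.dotProduct_star_self_pos_iff.mpr hv
  obtain ⟨hre, him⟩ := Complex.pos_iff.mp hvv
  have h2 : ∑ i, (z i).im * (q i).re = 0 := by
    have := congrArg Complex.im h1
    simpa [← him, fun i => show (q i).im = 0 from (hq i).2.symm] using this
  have h3 : ∀ i, q i = 0 := by
    intro i
    have := (Finset.sum_eq_zero_iff_of_nonneg
      fun i _ => mul_nonneg (hz i).le (hq i).1).mp h2 i (Finset.mem_univ i)
    exact Complex.ext ((mul_eq_zero.mp this).resolve_left (hz i).ne') (hq i).2.symm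
  simp only [h3, mul_zero, Finset.sum_const_zero, add_zero, mul_eq_zero, Complex.ofReal_eq_zero]
    at h1
  exact h1.elim hx.ne' hvv.ne'

theorem pencil_eq (x δ : ℝ) (X : Fin m → Matrix (Fin d) (Fin d) ℂ) (b : Fin m → ℝ) :
    (x : ℂ) • (1 : Matrix (Fin d) (Fin d) ℂ) + ∑ i, (b i : ℂ) • X i =
      ((x - δ : ℝ) : ℂ) • 1 + ((δ : ℂ) • (1 - ∑ i, X i) + ∑ i, ((b i + δ : ℝ) : ℂ) • X i) := by
  push_cast
  simp only [add_smul, sub_smul, smul_sub, Finset.sum_add_distrib, ← Finset.smul_sum]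
  abel

theorem posSemidef_pencil {δ : ℝ} (hδ : 0 ≤ δ) {X : Fin m → Matrix (Fin d) (Fin d) ℂ}
    (hX : ∀ i, (X i).PosSemidef) (hsum : (1 - ∑ i, X i).PosSemidef) {b : Fin m → ℝ}
    (hb : ∀ i, -δ ≤ b i) :
    ((δ : ℂ) • (1 - ∑ i, X i) + ∑ i, ((b i + δ : ℝ) : ℂ) • X i).PosSemidef := by
  refine (hsum.smul (Complex.zero_le_real.mpr hδ)).add ?_
  refine Matrix.posSemidef_sum _ fun i _ => (hX i).smul (Complex.zero_le_real.mpr ?_)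
  linarith [hb i]

theorem isAboveRoots_of_map_eq_detPencil {p : MvPolynomial (Fin m) ℝ} {x δ : ℝ} (hδ : 0 ≤ δ)
    (hx : δ < x) {X : Fin m → Matrix (Fin d) (Fin d) ℂ} (hX : ∀ i, (X i).PosSemidef)
    (hsum : (1 - ∑ i, X i).PosSemidef)
    (hp : MvPolynomial.map (algebraMap ℝ ℂ) p = detPencil x X) :
    IsAboveRoots p fun _ => -δ := by
  intro b hb
  rw [← Complex.zero_lt_real, ofReal_eval_eq_det hp, pencil_eq x δ]
  exact ((Matrix.PosDef.one.smul (Complex.zero_lt_real.mpr (sub_pos.mpr hx))).add_posSemidef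
    (posSemidef_pencil hδ hX hsum hb)).det_pos

theorem degreeOf_det_le {σ R n : Type*} [CommRing R] [Fintype n] [DecidableEq n]
    (M : Matrix n n (MvPolynomial σ R)) (j : σ) (S : Finset n)
    (hM : ∀ r c, (M r c).degreeOf j ≤ if r ∈ S then 1 else 0) :
    M.det.degreeOf j ≤ S.card := by
  rw [← Matrix.det_transpose, Matrix.det_apply']
  refine (MvPolynomial.degreeOf_sum_le _ _ _).trans (Finset.sup_le fun s _ => ?_)
  rw [← map_intCast (MvPolynomial.C : R →+* MvPolynomial σ R)]
  refine (MvPolynomial.degreeOf_C_mul_le _ _ _).trans ?_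
  refine (MvPolynomial.degreeOf_prod_le _ _ _).trans ?_
  refine (Finset.sum_le_sum fun r _ => hM r (s r)).trans ?_
  simp

theorem detPencil_conj (x : ℂ) (X : Fin m → Matrix (Fin d) (Fin d) ℂ)
    {U V : Matrix (Fin d) (Fin d) ℂ} (hVU : V * U = 1) :
    detPencil x (fun i => V * X i * U) = detPencil x X := by
  refine MvPolynomial.funext fun z => ?_
  rw [eval_detPencil, eval_detPencil]
  have : x • 1 + ∑ i, z i • (V * X i * U) = V * (x • 1 + ∑ i, z i • X i) * U := by
    simp [mul_add, add_mul, Finset.mul_sum, Finset.sum_mul, hVU]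
  rw [this, Matrix.det_mul, Matrix.det_mul, mul_right_comm, ← Matrix.det_mul, hVU,
    Matrix.det_one, one_mul]

theorem degreeOf_detPencil_le (x : ℂ) (X : Fin m → Matrix (Fin d) (Fin d) ℂ) (j : Fin m)
    (hX : (X j).IsHermitian) : (detPencil x X).degreeOf j ≤ (X j).rank := by
  obtain ⟨U, hU⟩ : ∃ U : Matrix (Fin d) (Fin d) ℂ, U = hX.eigenvectorUnitary := ⟨_, rfl⟩
  have hVU : star U * U = 1 := by
    rw [hU]
    exact Unitary.coe_star_mul_self _
  have hD : star U * X j * U = Matrix.diagonal (RCLike.ofReal ∘ hX.eigenvalues) := by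
    rw [hU]
    simpa [Unitary.conjStarAlgAut_apply] using hX.conjStarAlgAut_star_eigenvectorUnitary
  rw [hX.rank_eq_card_non_zero_eigs, ← detPencil_conj x X hVU,
    Fintype.card_subtype]
  refine degreeOf_det_le _ _ _ fun r c => ?_
  simp only [Matrix.add_apply, Matrix.sum_apply, Matrix.smul_apply, Matrix.map_apply, smul_eq_mul]
  refine (MvPolynomial.degreeOf_add_le _ _ _).trans (max_le ?_ ?_)
  · rw [Matrix.diagonal_apply]
    split_ifs <;> simp
  refine (MvPolynomial.degreeOf_sum_le _ _ _).trans (Finset.sup_le fun i _ => ?_)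
  by_cases hij : j = i
  · subst hij
    rw [hD, Matrix.diagonal_apply]
    by_cases hr : hX.eigenvalues r = 0
    · simp [hr]
    · refine (MvPolynomial.degreeOf_mul_C_le _ _ _).trans ?_
      simp [hr]
  · refine (MvPolynomial.degreeOf_mul_C_le _ _ _).trans ?_
    simp [MvPolynomial.degreeOf_X, hij]

theorem degreeOf_of_map_eq_detPencil {p : MvPolynomial (Fin m) ℝ} {x : ℂ}
    {X : Fin m → Matrix (Fin d) (Fin d) ℂ}
    (hp : MvPolynomial.map (algebraMap ℝ ℂ) p = detPencil x X) (j : Fin m)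
    (hX : (X j).IsHermitian) : p.degreeOf j ≤ (X j).rank := by
  refine le_trans (le_of_eq ?_) (degreeOf_detPencil_le x X j hX)
  rw [← hp, MvPolynomial.degreeOf_eq_sup, MvPolynomial.degreeOf_eq_sup,
    MvPolynomial.support_map_of_injective _ (algebraMap ℝ ℂ).injective]

theorem ofReal_eval_pderiv_eq {p : MvPolynomial (Fin m) ℝ} {x : ℂ}
    {X : Fin m → Matrix (Fin d) (Fin d) ℂ}
    (hp : MvPolynomial.map (algebraMap ℝ ℂ) p = detPencil x X) (b : Fin m → ℝ) (j : Fin m)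
    (hdet : IsUnit (Matrix.det (x • 1 + ∑ i, (b i : ℂ) • X i))) :
    (MvPolynomial.eval b (MvPolynomial.pderiv j p) : ℂ) = MvPolynomial.eval b p *
      Matrix.trace ((x • 1 + ∑ i, (b i : ℂ) • X i)⁻¹ * X j) := by
  set A := x • 1 + ∑ i, (b i : ℂ) • X i with hA
  have hAu : A * A⁻¹ = 1 := Matrix.mul_nonsing_inv A hdet
  have hline : lineRestrict p (fun i => (b i : ℂ)) (Pi.single j 1) =
      C A.det * (1 + (Polynomial.X : ℂ[X]) • (A⁻¹ * X j).map C).det := by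
    refine Polynomial.funext fun u => ?_
    rw [eval_lineRestrict, aeval_eq_det hp, eval_mul, eval_C, ← coe_evalRingHom, RingHom.map_det,
      ← Matrix.det_mul]
    congr 1
    have h1 : (evalRingHom u).mapMatrix (1 + (Polynomial.X : ℂ[X]) • (A⁻¹ * X j).map C) =
        1 + u • (A⁻¹ * X j) := by
      ext r c
      by_cases h : r = c <;> simp [h, -Matrix.map_mul, mul_comm u]
    rw [h1, mul_add, mul_one, mul_smul_comm, ← mul_assoc, hAu, one_mul, hA]
    simp [add_smul, Finset.sum_add_distrib, Pi.single_apply, add_assoc]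
  have h0 := congrArg (fun q => (derivative q).eval 0) hline
  simp only [derivative_lineRestrict, derivative_mul, derivative_C, zero_mul, zero_add, eval_mul,
    eval_C, Matrix.derivative_det_one_add_X_smul, eval_lineRestrict, mul_zero, add_zero] at h0
  rw [ofReal_eval_eq_det hp, ← hA, ← h0, ← MvPolynomial.aeval_eq_eval]
  exact (MvPolynomial.aeval_algebraMap_apply ℂ b _).symm

open scoped MatrixOrder in
/-- `tr (A⁻¹ Y) ≤ tr Y / t` for `A ⪰ t` and `Y ⪰ 0`. -/
theorem trace_inv_mul_le {A P Y : Matrix (Fin d) (Fin d) ℂ} {t : ℝ} (ht : 0 < t)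
    (hA : A = (t : ℂ) • 1 + P) (hP : P.PosSemidef) (hY : Y.PosSemidef) :
    t * (Matrix.trace (A⁻¹ * Y)).re ≤ (Matrix.trace Y).re := by
  have hApos : A.PosDef := hA ▸
    (Matrix.PosDef.one.smul (Complex.zero_lt_real.mpr ht)).add_posSemidef hP
  have hAu : IsUnit A.det := isUnit_iff_ne_zero.mpr hApos.det_pos.ne'
  have hPP : (P * P).PosSemidef := by
    simpa [hP.isHermitian.eq] using Matrix.posSemidef_conjTranspose_mul_self P
  have hQ : 1 - (t : ℂ) • A⁻¹ = A⁻¹.conjTranspose * ((t : ℂ) • P + P * P) * A⁻¹ := by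
    rw [hApos.isHermitian.inv.eq]
    have h1 : (t : ℂ) • P + P * P = P * A := by rw [hA, mul_add, mul_smul_comm, mul_one]
    have h2 : P = A - (t : ℂ) • 1 := by rw [hA]; abel
    rw [h1, mul_assoc, mul_assoc, Matrix.mul_nonsing_inv A hAu, mul_one]
    rw [h2]
    rw [mul_sub, Matrix.nonsing_inv_mul A hAu, mul_smul_comm, mul_one]
  have hQpos : (1 - (t : ℂ) • A⁻¹).PosSemidef := hQ ▸
    ((hP.smul (Complex.zero_le_real.mpr ht.le)).add hPP).conjTranspose_mul_mul_same A⁻¹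
  obtain ⟨B, rfl⟩ := CStarAlgebra.nonneg_iff_eq_star_mul_self.mp hY.nonneg
  have h := (Complex.nonneg_iff.mp (hQpos.mul_mul_conjTranspose_same B).trace_nonneg).1
  rw [← Matrix.star_eq_conjTranspose, Matrix.trace_mul_comm, ← mul_assoc, Matrix.trace_mul_comm,
    sub_mul, one_mul, smul_mul_assoc, Matrix.trace_sub, Matrix.trace_smul, Complex.sub_re,
    smul_eq_mul, Complex.re_ofReal_mul] at h
  linarith

theorem eval_mixedCharPoly_ne_zero {X : Fin m → Matrix (Fin d) (Fin d) ℂ}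
    (hX : ∀ i, (X i).PosSemidef) (hsum : (1 - ∑ i, X i).PosSemidef) {x δ φ K : ℝ} (hδ : 0 < δ)
    (hx : δ < x) (hφ : 0 ≤ φ) (hK : 0 < K) (hcond : 1 / δ + φ / (1 + δ * φ / K) ≤ 1)
    (hrank : ∀ i, ((X i).rank : ℝ) ≤ K + 1)
    (htr : ∀ i, (Matrix.trace (X i)).re ≤ φ * (x - δ)) :
    (mixedCharPoly X).eval (x : ℂ) ≠ 0 := by
  obtain ⟨p, hp⟩ := exists_map_eq_detPencil x fun i => (hX i).isHermitian
  have ht : 0 < x - δ := sub_pos.mpr hx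
  have habove := isAboveRoots_of_map_eq_detPencil hδ.le hx hX hsum hp
  have hpa := habove _ le_rfl
  have hbar : ∀ i, MvPolynomial.eval (fun _ => -δ) (MvPolynomial.pderiv i p) ≤
      φ * MvPolynomial.eval (fun _ => -δ) p := by
    intro i
    have hdet := ofReal_eval_eq_det hp fun _ => -δ
    have h1 := ofReal_eval_pderiv_eq hp (fun _ => -δ) i
      (isUnit_iff_ne_zero.mpr (hdet ▸ Complex.ofReal_ne_zero.mpr hpa.ne'))
    have h2 := trace_inv_mul_le ht (pencil_eq x δ X fun _ => -δ)
      (posSemidef_pencil hδ.le hX hsum fun _ => le_rfl) (hX i)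
    have h3 := congrArg Complex.re h1
    rw [Complex.re_ofReal_mul, Complex.ofReal_re] at h3
    rw [h3, mul_comm]
    refine mul_le_mul_of_nonneg_right (le_of_mul_le_mul_left ?_ ht) hpa.le
    linarith [htr i]
  have hdeg : ∀ i, (p.degreeOf i : ℝ) ≤ K + 1 := fun i =>
    (Nat.cast_le.mpr (degreeOf_of_map_eq_detPencil hp i (hX i).isHermitian)).trans (hrank i)
  have hpos := (isRealStable_of_map_eq_detPencil (hδ.trans hx) hX hp).foldr_sub_pderiv habove hδ hφ
    hK hcond hdeg hbar (List.finRange m) (List.nodup_finRange m) 0 (fun i => by simp)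
  rw [eval_mixedCharPoly, ← hp, ← map_foldr_sub_pderiv, MvPolynomial.eval_map,
    ← MvPolynomial.aeval_def]
  have h0 := MvPolynomial.aeval_algebraMap_apply ℂ (0 : Fin m → ℝ)
    ((List.finRange m).foldr (fun i q => q - MvPolynomial.pderiv i q) p)
  rw [MvPolynomial.aeval_eq_eval] at h0
  have hz : (algebraMap ℝ ℂ) ∘ (0 : Fin m → ℝ) = 0 := by ext; simp
  rw [hz] at h0
  rw [h0]
  exact Complex.ofReal_ne_zero.mpr hpos.ne'

end DetPencil

/-- The choice of `δ` that makes the barrier condition hold at every `x` above the bound. -/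
theorem exists_shift {ε K x : ℝ} (hK : 0 < K) (hε : 0 ≤ ε) (hεK : ε ≤ K ^ 2 / (K + 1))
    (hx : (√(1 - ε / K) + √ε) ^ 2 < x) :
    ∃ δ, 0 < δ ∧ δ < x ∧ 1 / δ + ε / (x - δ) / (1 + δ * (ε / (x - δ)) / K) ≤ 1 := by
  rcases hε.eq_or_lt with rfl | hε'
  · have hx1 : 1 < x := by simpa using hx
    refine ⟨(1 + x) / 2, by linarith, by linarith, ?_⟩
    rw [zero_div, zero_div, add_zero, div_le_one (by linarith)]
    linarith
  have hεK' : ε * (K + 1) ≤ K ^ 2 := (le_div_iff₀ (by linarith)).mp hεK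
  have hs2 : 0 < 1 - ε / K := by
    rw [sub_pos, div_lt_one hK]
    nlinarith
  set s := √(1 - ε / K)
  set r := √ε
  have hs : 0 < s := Real.sqrt_pos.mpr hs2
  have hr : 0 < r := Real.sqrt_pos.mpr hε'
  have hrr : r ^ 2 = ε := Real.sq_sqrt hε
  have hss : s ^ 2 = 1 - r ^ 2 / K := by rw [hrr]; exact Real.sq_sqrt hs2.le
  have hrK : r ^ 2 / K = 1 - s ^ 2 := by linarith
  have hrs : r / K ≤ s := by
    refine abs_le_of_sq_le_sq' ?_ hs.le |>.2
    rw [hss, div_pow, hrr, div_le_iff₀ (by positivity)]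
    field_simp
    linarith
  have h1 : 1 ≤ s * (s + r) := by
    have := mul_le_mul_of_nonneg_left hrs hr.le
    have h2 : r * (r / K) = r ^ 2 / K := by ring
    nlinarith
  have hsr : 0 < s + r := by positivity
  have hδ : (s + r) / s ≤ (s + r) ^ 2 := by
    rw [div_le_iff₀ hs]
    nlinarith
  have ht : 0 < x - (s + r) / s := by linarith
  refine ⟨(s + r) / s, by positivity, by linarith, ?_⟩
  have hden : 0 < x - (s + r) / s + (s + r) / s * (r ^ 2 / K) := by positivity
  have h3 : ε / (x - (s + r) / s) / (1 + (s + r) / s * (ε / (x - (s + r) / s)) / K) =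
      r ^ 2 / (x - (s + r) / s + (s + r) / s * (r ^ 2 / K)) := by
    rw [← hrr, div_div]
    congr 1
    generalize x - (s + r) / s = t at ht
    field_simp
  have h4 : 1 / ((s + r) / s) = 1 - r / (s + r) := by
    field_simp
    ring
  have h5 : r ^ 2 / (x - (s + r) / s + (s + r) / s * (r ^ 2 / K)) ≤ r / (s + r) := by
    rw [div_le_div_iff₀ hden hsr]
    have h6 : (s + r) / s * (r ^ 2 / K) = (s + r) / s - s * (s + r) := by
      rw [hrK]
      field_simp
    rw [h6]
    nlinarith
  rw [h3, h4]
  linarith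

/-- If `X_1,…,X_m` are PSD of rank at most `k ≥ 2` with `Σ X_i ⪯ I_d`,
`tr(X_i) ≤ ε` for all `i`, and `ε ≤ (k−1)²/k`, then
`maxroot μ[X_1,…,X_m] ≤ (√(1 − ε/(k−1)) + √ε)²`. -/
theorem maxRoot_mixedCharPoly_le {m d : ℕ} (k : ℕ) (hk : 2 ≤ k)
    (X : Fin m → Matrix (Fin d) (Fin d) ℂ)
    (hX : ∀ i, (X i).PosSemidef) (hrank : ∀ i, (X i).rank ≤ k)
    (hsum : (1 - ∑ i, X i).PosSemidef)
    (ε : ℝ) (hε : ∀ i, (Matrix.trace (X i)).re ≤ ε)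
    (hεk : ε ≤ ((k : ℝ) - 1) ^ 2 / k) :
    maxRoot (mixedCharPoly X)
      ≤ (Real.sqrt (1 - ε / ((k : ℝ) - 1)) + Real.sqrt ε) ^ 2 := by
  have hK : 0 < (k : ℝ) - 1 := by
    have : (2 : ℝ) ≤ k := by exact_mod_cast hk
    linarith
  have hbound : (√(1 - max ε 0 / ((k : ℝ) - 1)) + √(max ε 0)) ^ 2 ≤
      (√(1 - ε / ((k : ℝ) - 1)) + √ε) ^ 2 := by
    rcases le_total 0 ε with h | h
    · rw [max_eq_left h]
    · rw [max_eq_right h, Real.sqrt_eq_zero'.mpr h, zero_div, sub_zero, Real.sqrt_zero, add_zero,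
        add_zero]
      have : ε / ((k : ℝ) - 1) ≤ 0 := div_nonpos_of_nonpos_of_nonneg h hK.le
      gcongr
      linarith
  refine Real.sSup_le (fun x hx => ?_) (sq_nonneg _)
  refine le_trans ?_ hbound
  by_contra! hlt
  obtain ⟨δ, hδ, hδx, hcond⟩ := exists_shift hK (le_max_right ε 0)
    (max_le (by simpa using hεk) (by positivity)) hlt
  refine eval_mixedCharPoly_ne_zero hX hsum hδ hδx
    (div_nonneg (le_max_right ε 0) (sub_pos.mpr hδx).le) hK hcond (fun i => ?_) (fun i => ?_) hx
  · rw [sub_add_cancel]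
    exact_mod_cast hrank i
  · rw [div_mul_cancel₀ _ (sub_pos.mpr hδx).ne']
    exact (hε i).trans (le_max_left ε 0)
end

section
/- For positive semidefinite Hermitian matrices A_1,...,A_l ∈ ℂ^{km×km} and a Hermitian matrix B ∈ ℂ^{km×km}, the polynomial f(x_1,...,x_l) := D_{k,m}[A_1 x_1 + ... + A_l x_l + B] is either real stable or identically zero. -/
open scoped ComplexOrder

/-- The `(k,m)`-determinant `D_{k,m}[M] = Σ_{S ∈ P_k(m)} det[M(S)]`, with
`k`-partitions of `[m]` encoded as functions `g : Fin m → Fin k` and the index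
`i+(j−1)m` of the paper corresponding to the pair `(j,i) : Fin k × Fin m`. -/
noncomputable def kmDet {k m : ℕ} {R : Type*} [CommRing R]
    (M : Matrix (Fin k × Fin m) (Fin k × Fin m) R) : R :=
  ∑ g : Fin m → Fin k,
    Matrix.det (M.submatrix (fun i : Fin m => (g i, i)) (fun i : Fin m => (g i, i)))

/-- The quadratic form of `M` has positive imaginary part away from the origin. -/
def ImPos {I : Type*} [Fintype I] (M : Matrix I I ℂ) : Prop :=
  ∀ v : I → ℂ, v ≠ 0 → 0 < (star v ⬝ᵥ M.mulVec v).im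

/-- The principal minor of `M` on `s`, as the determinant of the matrix obtained from `M` by
replacing the rows outside `s` by those of the identity. -/
noncomputable def principalMinor {I R : Type*} [Fintype I] [DecidableEq I] [CommRing R]
    (M : Matrix I I R) (s : Finset I) : R :=
  Matrix.det (Matrix.of fun i => if i ∈ s then M i else Pi.single i 1)

/-- The sum of the principal minors on `s ∪ {a₁, …, aₙ}` over all choices of one index `aᵢ` from
each of the listed sets. -/
noncomputable def transversalSum {I R : Type*} [Fintype I] [DecidableEq I] [CommRing R]
    (M : Matrix I I R) : List (Finset I) → Finset I → R
  | [], s => principalMinor M s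
  | G :: L, s => ∑ a ∈ G, transversalSum M L (insert a s)

section

variable {I : Type*} [Fintype I] [DecidableEq I]

theorem ImPos.add_single {M : Matrix I I ℂ} (hM : ImPos M) (a : I) {t : ℂ} (ht : 0 ≤ t.im) :
    ImPos (M + Matrix.single a a t) := by
  intro v hv
  have h : star v ⬝ᵥ (M + Matrix.single a a t).mulVec v
      = star v ⬝ᵥ M.mulVec v + t * (Complex.normSq (v a) : ℂ) := by
    rw [Matrix.add_mulVec, dotProduct_add, Matrix.single_mulVec]
    congr 1
    rw [← Complex.mul_conj]
    simp [dotProduct, Function.update_apply]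
    ring
  rw [h, Complex.add_im, Complex.im_mul_ofReal]
  exact add_pos_of_pos_of_nonneg (hM v hv) (mul_nonneg ht (Complex.normSq_nonneg _))

theorem ImPos.principalMinor_ne_zero {M : Matrix I I ℂ} (hM : ImPos M) (s : Finset I) :
    principalMinor M s ≠ 0 := by
  intro h
  obtain ⟨v, hv, h0⟩ := Matrix.exists_mulVec_eq_zero_iff.mpr h
  have hpos := hM v hv
  have hzero : star v ⬝ᵥ M.mulVec v = 0 := by
    refine Finset.sum_eq_zero fun i _ => ?_
    have hi := congrFun h0 i
    by_cases his : i ∈ s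
    · have : M.mulVec v i = 0 := by simpa [Matrix.mulVec, his] using hi
      simp [this]
    · have : v i = 0 := by simpa [Matrix.mulVec, his] using hi
      simp [this]
  simp [hzero] at hpos

theorem principalMinor_add_single {R : Type*} [CommRing R] (M : Matrix I I R) {s : Finset I}
    {a : I} (ha : a ∉ s) (t : R) :
    principalMinor (M + Matrix.single a a t) (insert a s)
      = principalMinor M (insert a s) + t * principalMinor M s := by
  set N : Matrix I I R := Matrix.of fun i => if i ∈ s then M i else Pi.single i 1 with hN
  have h1 : (Matrix.of fun i => if i ∈ insert a s then (M + Matrix.single a a t) i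
      else Pi.single i 1) = N.updateRow a (M a + t • Pi.single a 1) := by
    ext i j
    by_cases hi : i = a
    · subst hi
      simp [Matrix.single_apply, Pi.single_apply, eq_comm]
    · have hi' : a ≠ i := fun h => hi h.symm
      by_cases his : i ∈ s <;> simp [hN, hi, hi', his]
  have h2 : (Matrix.of fun i => if i ∈ insert a s then M i else Pi.single i 1)
      = N.updateRow a (M a) := by
    ext i j
    by_cases hi : i = a
    · subst hi
      simp
    · by_cases his : i ∈ s <;> simp [hN, hi, his]
  have h3 : N.updateRow a (Pi.single a 1) = N := by
    ext i j
    by_cases hi : i = a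
    · subst hi
      simp [hN, ha]
    · simp [hi]
  rw [principalMinor, principalMinor, principalMinor, h1, h2, Matrix.det_updateRow_add,
    Matrix.det_updateRow_smul, h3]

theorem principalMinor_image {R J : Type*} [CommRing R] [Fintype J] [DecidableEq J]
    (M : Matrix I I R) {e : J → I} (he : Function.Injective e) :
    principalMinor M (Finset.univ.image e) = (M.submatrix e e).det := by
  set N : Matrix I I R :=
    Matrix.of fun i => if i ∈ Finset.univ.image e then M i else Pi.single i 1 with hN
  let p : I → Prop := fun i => i ∈ Finset.univ.image e
  have hNp : ∀ i, p i → N i = M i := fun i hi => if_pos hi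
  have hNn : ∀ i, ¬ p i → N i = Pi.single i 1 := fun i hi => if_neg hi
  have hone : Matrix.toSquareBlockProp N (fun i => ¬ p i) = 1 := by
    ext ⟨i, hi⟩ ⟨j, hj⟩
    rw [Matrix.toSquareBlockProp_def, Matrix.of_apply, hNn i hi, Pi.single_apply,
      Matrix.one_apply]
    simp only [Subtype.mk.injEq, eq_comm]
  let φ : J ≃ {i // p i} :=
    Equiv.ofBijective (fun j => ⟨e j, Finset.mem_image_of_mem e (Finset.mem_univ j)⟩)
      ⟨fun x y hxy => he (Subtype.mk.inj hxy), by
        rintro ⟨i, hi⟩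
        obtain ⟨j, -, rfl⟩ := Finset.mem_image.mp hi
        exact ⟨j, rfl⟩⟩
  have hsub : M.submatrix e e = (Matrix.toSquareBlockProp N p).submatrix φ φ := by
    ext i j
    exact (congrFun (hNp (e i) (φ i).2) (e j)).symm
  have hblock := Matrix.twoBlockTriangular_det N p fun i hi j hj => by
    have hij : j ≠ i := fun h => hi (h ▸ hj)
    rw [hNn i hi, Pi.single_apply, if_neg hij]
  rw [hsub, Matrix.det_submatrix_equiv_self, principalMinor, ← hN, hblock, hone,
    Matrix.det_one, mul_one]

theorem transversalSum_add_single {R : Type*} [CommRing R] (M : Matrix I I R) {a : I} (t : R)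
    (L : List (Finset I)) (hL : ∀ G ∈ L, a ∉ G) {s : Finset I} (ha : a ∉ s) :
    transversalSum (M + Matrix.single a a t) L (insert a s)
      = transversalSum M L (insert a s) + t * transversalSum M L s := by
  induction L generalizing s with
  | nil => exact principalMinor_add_single M ha t
  | cons G L ih =>
    simp only [transversalSum, Finset.mul_sum, ← Finset.sum_add_distrib]
    refine Finset.sum_congr rfl fun b hb => ?_
    have hba : a ≠ b := fun h => hL G (by simp) (h ▸ hb)
    rw [Finset.insert_comm b a]
    exact ih (fun G' hG' => hL G' (by simp [hG'])) (by simp [hba, ha])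

theorem im_div_pos_of_forall_add_mul_ne_zero {x y : ℂ} (hy : y ≠ 0)
    (h : ∀ t : ℂ, 0 ≤ t.im → x + t * y ≠ 0) : 0 < (x / y).im := by
  by_contra hneg
  refine h (-(x / y)) (by rw [Complex.neg_im]; linarith) ?_
  field_simp
  ring

theorem ImPos.transversalSum_ne_zero {M : Matrix I I ℂ} (hM : ImPos M) (L : List (Finset I))
    (hne : ∀ G ∈ L, G.Nonempty) (hL : L.Pairwise Disjoint) {s : Finset I}
    (hs : ∀ G ∈ L, Disjoint G s) : transversalSum M L s ≠ 0 := by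
  induction L generalizing s M with
  | nil => exact hM.principalMinor_ne_zero s
  | cons G L ih =>
    rw [List.pairwise_cons] at hL
    have hne' : ∀ G' ∈ L, G'.Nonempty := fun G' h => hne G' (by simp [h])
    have hs' : ∀ G' ∈ L, Disjoint G' s := fun G' h => hs G' (by simp [h])
    have hy : transversalSum M L s ≠ 0 := ih hM hne' hL.2 hs'
    have hterm : ∀ a ∈ G, 0 < (transversalSum M L (insert a s) / transversalSum M L s).im := by
      intro a ha
      have haL : ∀ G' ∈ L, a ∉ G' := fun G' h => Finset.disjoint_left.mp (hL.1 G' h) ha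
      refine im_div_pos_of_forall_add_mul_ne_zero hy fun t ht => ?_
      rw [← transversalSum_add_single M t L haL
        (Finset.disjoint_left.mp (hs G (by simp)) ha)]
      refine ih (hM.add_single a ht) hne' hL.2 fun G' h => ?_
      rw [Finset.disjoint_insert_right]
      exact ⟨haL G' h, hs' G' h⟩
    have hsum : 0 < (transversalSum M (G :: L) s / transversalSum M L s).im := by
      rw [transversalSum, Finset.sum_div, Complex.im_sum]
      exact Finset.sum_pos hterm (hne G (by simp))
    intro h0
    simp [h0] at hsum

theorem transversalSum_ofFn {R κ : Type*} [CommRing R] [Fintype κ] (M : Matrix I I R) {n : ℕ}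
    (e : Fin n → κ → I) (he : ∀ i, Function.Injective (e i)) (s : Finset I) :
    transversalSum M (List.ofFn fun i => Finset.univ.image (e i)) s
      = ∑ g : Fin n → κ, principalMinor M (s ∪ Finset.univ.image fun i => e i (g i)) := by
  induction n generalizing s with
  | zero => simp [transversalSum]
  | succ n ih =>
    rw [List.ofFn_succ, transversalSum, Finset.sum_image fun x _ y _ h => he 0 h,
      ← (Fin.consEquiv fun _ => κ).sum_comp, Fintype.sum_prod_type]
    refine Finset.sum_congr rfl fun a _ => ?_
    rw [ih (fun i => e i.succ) (fun i => he i.succ)]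
    refine Finset.sum_congr rfl fun g _ => ?_
    congr 1
    ext x
    simp [Fin.exists_fin_succ, Fin.consEquiv, eq_comm, or_left_comm]

end

theorem kmDet_eq_transversalSum {k m : ℕ} {R : Type*} [CommRing R]
    (M : Matrix (Fin k × Fin m) (Fin k × Fin m) R) :
    kmDet M = transversalSum M
      (List.ofFn fun i => Finset.univ.image fun j => (j, i)) ∅ := by
  rw [transversalSum_ofFn M (fun i j => (j, i)) (fun i x y h => congrArg Prod.fst h)]
  refine Finset.sum_congr rfl fun g _ => ?_
  rw [Finset.empty_union, principalMinor_image M fun x y h => congrArg Prod.snd h]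

theorem ImPos.kmDet_ne_zero {k m : ℕ} (hkm : m ≠ 0 → k ≠ 0)
    {M : Matrix (Fin k × Fin m) (Fin k × Fin m) ℂ} (hM : ImPos M) : kmDet M ≠ 0 := by
  rw [kmDet_eq_transversalSum]
  refine hM.transversalSum_ne_zero _ ?_ ?_ (by simp)
  · intro G hG
    obtain ⟨i, rfl⟩ := (List.mem_ofFn' _ _).mp hG
    have hk : NeZero k := ⟨hkm (Nat.ne_of_gt (Nat.zero_lt_of_lt i.2))⟩
    exact Finset.univ_nonempty.image _
  · rw [List.pairwise_ofFn]
    intro i j hij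
    rw [Finset.disjoint_left]
    simp only [Finset.mem_image, Finset.mem_univ, true_and]
    rintro _ ⟨a, rfl⟩ ⟨b, hb⟩
    exact hij.ne' (congrArg Prod.snd hb)

theorem map_kmDet {k m : ℕ} {R S : Type*} [CommRing R] [CommRing S] (φ : R →+* S)
    (M : Matrix (Fin k × Fin m) (Fin k × Fin m) R) : φ (kmDet M) = kmDet (M.map φ) := by
  simp only [kmDet, map_sum, RingHom.map_det]
  rfl

theorem kmDet_transpose {k m : ℕ} {R : Type*} [CommRing R]
    (M : Matrix (Fin k × Fin m) (Fin k × Fin m) R) : kmDet M.transpose = kmDet M := by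
  refine Finset.sum_congr rfl fun g _ => ?_
  rw [← Matrix.transpose_submatrix, Matrix.det_transpose]

theorem continuous_kmDet {k m : ℕ} {X : Type*} [TopologicalSpace X]
    {M : X → Matrix (Fin k × Fin m) (Fin k × Fin m) ℂ} (hM : Continuous M) :
    Continuous fun x => kmDet (M x) :=
  continuous_finsetSum _ fun _ _ => (hM.matrix_submatrix _ _).matrix_det

theorem imPos_of_posSemidef {I : Type*} [Fintype I] [DecidableEq I] {l : ℕ}
    {A : Fin l → Matrix I I ℂ} (hA : ∀ i, (A i).PosSemidef) {B : Matrix I I ℂ}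
    (hB : B.IsHermitian) {z : Fin l → ℂ} (hz : ∀ i, 0 ≤ (z i).im) {w : ℂ} (hw : 0 < w.im) :
    ImPos (∑ i, z i • A i + B + w • 1) := by
  intro v hv
  simp only [Matrix.add_mulVec, Matrix.sum_mulVec, Matrix.smul_mulVec, Matrix.one_mulVec,
    dotProduct_add, dotProduct_sum, dotProduct_smul, smul_eq_mul, Complex.add_im, Complex.im_sum,
    Complex.mul_im]
  have hAv : ∀ i, 0 ≤ (star v ⬝ᵥ (A i).mulVec v).re ∧ (star v ⬝ᵥ (A i).mulVec v).im = 0 := by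
    intro i
    have h := Complex.le_def.mp ((hA i).dotProduct_mulVec_nonneg v)
    exact ⟨h.1, h.2.symm⟩
  have hBv : (star v ⬝ᵥ B.mulVec v).im = 0 := hB.im_star_dotProduct_mulVec_self v
  have hv' : 0 < (star v ⬝ᵥ v).re ∧ (star v ⬝ᵥ v).im = 0 := by
    have h := Complex.lt_def.mp (Matrix.dotProduct_star_self_pos_iff.mpr hv)
    exact ⟨h.1, h.2.symm⟩
  simp only [hBv, hv'.2, (hAv _).2, mul_zero, zero_add, add_zero]
  exact add_pos_of_nonneg_of_pos
    (Finset.sum_nonneg fun i _ => mul_nonneg (hz i) (hAv i).1) (mul_pos hw hv'.1)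

/-- A form of Hurwitz's theorem: if `F t ε` is nonvanishing near `t = 0` for small `ε > 0`, then
the limit `F · 0` is nonvanishing at `0` or vanishes identically. -/
theorem eq_zero_of_apply_zero_of_forall_ne_zero {F : ℂ → ℝ → ℂ}
    (hF : Continuous fun p : ℂ × ℝ => F p.1 p.2)
    (hd : ∀ ε, Differentiable ℂ fun t => F t ε) {r₀ : ℝ} (hr₀ : 0 < r₀)
    (hne : ∀ t ε, ‖t‖ < r₀ → 0 < ε → F t ε ≠ 0) (h0 : F 0 0 = 0) (t : ℂ) : F t 0 = 0 := by
  have han : AnalyticOnNhd ℂ (fun t => F t 0) Set.univ := fun x _ => (hd 0).analyticAt x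
  rcases (han 0 trivial).eventually_eq_zero_or_eventually_ne_zero with h | h
  · exact han.eqOn_zero_of_preconnected_of_eventuallyEq_zero isPreconnected_univ
      (Set.mem_univ 0) h (Set.mem_univ t)
  exfalso
  rw [eventually_nhdsWithin_iff, Metric.eventually_nhds_iff] at h
  obtain ⟨r₁, hr₁, h⟩ := h
  set r := min r₀ r₁ / 2 with hr_def
  have hmin : 0 < min r₀ r₁ := lt_min hr₀ hr₁
  have hr : 0 < r := by positivity
  have hrr₀ : r < r₀ := (half_lt_self hmin).trans_le (min_le_left _ _)
  have hrr₁ : r < r₁ := (half_lt_self hmin).trans_le (min_le_right _ _)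
  have hsphere : ∀ x ∈ Metric.sphere (0 : ℂ) r, F x 0 ≠ 0 := by
    intro x hx
    rw [mem_sphere_zero_iff_norm] at hx
    refine h (by simpa [hx] using hrr₁) ?_
    rintro rfl
    simp at hx
    exact hr.ne hx
  obtain ⟨δ, hδ, hδF⟩ : ∃ δ > 0, ∀ x ∈ Metric.sphere (0 : ℂ) r, δ < ‖F x 0‖ := by
    have hcont : Continuous fun x : ℂ => ‖F x 0‖ :=
      (hF.comp (by fun_prop : Continuous fun x : ℂ => (x, (0 : ℝ)))).norm
    obtain ⟨x₀, hx₀, hmin⟩ := (isCompact_sphere (0 : ℂ) r).exists_isMinOn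
      (NormedSpace.sphere_nonempty.mpr hr.le) hcont.continuousOn
    have hpos : 0 < ‖F x₀ 0‖ := norm_pos_iff.mpr (hsphere x₀ hx₀)
    exact ⟨‖F x₀ 0‖ / 2, by positivity, fun x hx => (half_lt_self hpos).trans_le (hmin hx)⟩
  have hev : ∀ᶠ ε in nhds (0 : ℝ), ∀ x ∈ Metric.sphere (0 : ℂ) r, δ < ‖F x ε‖ := by
    refine (isCompact_sphere (0 : ℂ) r).eventually_forall_of_forall_eventually fun x hx => ?_
    have hcont : Continuous fun p : ℝ × ℂ => ‖F p.2 p.1‖ := (hF.comp continuous_swap).norm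
    exact hcont.continuousAt.eventually (lt_mem_nhds (hδF x hx))
  have hev' : ∀ᶠ ε in nhds (0 : ℝ), ‖F 0 ε‖ < δ := by
    have hcont : Continuous fun ε : ℝ => ‖F 0 ε‖ :=
      (hF.comp (by fun_prop : Continuous fun ε : ℝ => ((0 : ℂ), ε))).norm
    refine hcont.continuousAt.eventually (gt_mem_nhds ?_)
    simpa [h0] using hδ
  obtain ⟨ε, ⟨hε1, hε2⟩, hε⟩ :=
    (((hev.and hev').filter_mono nhdsWithin_le_nhds).and
      (self_mem_nhdsWithin (s := Set.Ioi (0 : ℝ)))).exists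
  have hnz : ∀ x ∈ Metric.closedBall (0 : ℂ) r, F x ε ≠ 0 := by
    intro x hx
    exact hne x ε ((mem_closedBall_zero_iff.mp hx).trans_lt hrr₀) hε
  have hdiff : DiffContOnCl ℂ (fun x => (F x ε)⁻¹) (Metric.ball 0 r) := by
    refine DifferentiableOn.diffContOnCl ?_
    rw [closure_ball _ hr.ne']
    exact (hd ε).differentiableOn.inv hnz
  have hle : ‖(F 0 ε)⁻¹‖ ≤ δ⁻¹ := by
    refine Complex.norm_le_of_forall_mem_frontier_norm_le Metric.isBounded_ball hdiff ?_
      (subset_closure (Metric.mem_ball_self hr))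
    intro x hx
    rw [frontier_ball _ hr.ne'] at hx
    rw [norm_inv]
    exact inv_anti₀ hδ (hε1 x hx).le
  have hpos : 0 < ‖F 0 ε‖ := norm_pos_iff.mpr (hnz 0 (Metric.mem_closedBall_self hr.le))
  rw [norm_inv, inv_le_inv₀ hpos hδ] at hle
  exact absurd hε2 (not_lt.mpr hle)

theorem MvPolynomial.im_coeff_kmDet_eq_zero {k m : ℕ} {σ : Type*}
    {M : Matrix (Fin k × Fin m) (Fin k × Fin m) (MvPolynomial σ ℂ)}
    (hM : M.map (MvPolynomial.map (starRingEnd ℂ)) = M.transpose) (s : σ →₀ ℕ) :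
    (MvPolynomial.coeff s (kmDet M)).im = 0 := by
  have h : MvPolynomial.map (starRingEnd ℂ) (kmDet M) = kmDet M := by
    rw [map_kmDet, hM, kmDet_transpose]
  have hs := congrArg (MvPolynomial.coeff s) h
  rw [MvPolynomial.coeff_map] at hs
  exact Complex.conj_eq_iff_im.mp hs

/-- For PSD `A_1,…,A_l` and Hermitian `B`, the polynomial
`f(x_1,…,x_l) = D_{k,m}[A_1 x_1 + … + A_l x_l + B]` is either identically zero or
real stable (real coefficients and no zeros in the open upper half-planes). -/
theorem kmDet_real_stable {k m l : ℕ}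
    (A : Fin l → Matrix (Fin k × Fin m) (Fin k × Fin m) ℂ)
    (hA : ∀ i, (A i).PosSemidef)
    (B : Matrix (Fin k × Fin m) (Fin k × Fin m) ℂ) (hB : B.IsHermitian)
    (f : MvPolynomial (Fin l) ℂ)
    (hf : f = kmDet
      (∑ i : Fin l,
          (MvPolynomial.X i : MvPolynomial (Fin l) ℂ) • (A i).map MvPolynomial.C
        + B.map MvPolynomial.C)) :
    f = 0 ∨
      ((∀ s : Fin l →₀ ℕ, (MvPolynomial.coeff s f).im = 0) ∧
        ∀ z : Fin l → ℂ, (∀ i, 0 < (z i).im) → MvPolynomial.eval z f ≠ 0) := by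
  by_cases hkm : m ≠ 0 → k ≠ 0
  swap
  · push Not at hkm
    obtain ⟨hm, rfl⟩ := hkm
    have : NeZero m := ⟨hm⟩
    left
    rw [hf, kmDet, Finset.univ_eq_empty, Finset.sum_empty]
  have heval : ∀ z : Fin l → ℂ, MvPolynomial.eval z f = kmDet (∑ i, z i • A i + B) := by
    intro z
    rw [hf, map_kmDet]
    congr 1
    ext a b
    simp [Matrix.sum_apply]
  by_cases hz : ∃ z : Fin l → ℂ, (∀ i, 0 < (z i).im) ∧ MvPolynomial.eval z f = 0
  · left
    obtain ⟨z, hz, hz0⟩ := hz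
    refine MvPolynomial.funext fun w => ?_
    rw [map_zero, heval]
    let u : ℂ → Fin l → ℂ := fun t i => z i + t * (w i - z i)
    let F : ℂ → ℝ → ℂ := fun t ε =>
      kmDet (∑ i, u t i • A i + B + ((ε : ℂ) * Complex.I) • (1 : Matrix _ _ ℂ))
    have hu : Continuous u := by fun_prop
    obtain ⟨r, hr, hur⟩ : ∃ r > 0, ∀ t : ℂ, ‖t‖ < r → ∀ i, 0 < (u t i).im := by
      have hopen : ∀ᶠ t in nhds (0 : ℂ), ∀ i, 0 < (u t i).im := by
        refine Filter.eventually_all.mpr fun i => ?_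
        have hcont : Continuous fun t => (u t i).im := by fun_prop
        exact hcont.continuousAt.eventually (lt_mem_nhds (by simpa [u] using hz i))
      obtain ⟨r, hr, h⟩ := Metric.eventually_nhds_iff.mp hopen
      exact ⟨r, hr, fun t ht => h (by simpa using ht)⟩
    have h := eq_zero_of_apply_zero_of_forall_ne_zero (F := F)
      (continuous_kmDet (by fun_prop)) ?_ hr ?_ ?_ 1
    · simpa [F, u] using h
    · intro ε
      simp only [F, u, kmDet, Matrix.det_apply, Matrix.submatrix_apply, Matrix.add_apply,
        Matrix.sum_apply, Matrix.smul_apply, smul_eq_mul]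
      fun_prop
    · intro t ε ht hε
      exact (imPos_of_posSemidef hA hB (fun i => (hur t ht i).le) (by simpa using hε)).kmDet_ne_zero
        hkm
    · rw [heval] at hz0
      simpa [F, u] using hz0
  · right
    push Not at hz
    refine ⟨fun s => ?_, hz⟩
    rw [hf]
    refine MvPolynomial.im_coeff_kmDet_eq_zero ?_ s
    have hconj : ∀ {C : Matrix (Fin k × Fin m) (Fin k × Fin m) ℂ}, C.IsHermitian →
        ∀ a b, (starRingEnd ℂ) (C a b) = C b a := fun hC a b => hC.apply b a
    ext1 a b
    simp [Matrix.sum_apply, hconj hB, fun i => hconj (hA i).isHermitian]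
end
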